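/- arXiv:1108.0049 — 5 statements merged into one kernel-verified Lean document; each statement's English description precedes it below -/
import Mathlib

section
/- Let H be a complex Hilbert space and let (P_α)_{α∈A} be a net of orthogonal projections in B(H) converging to the identity in the *-strong operator topology. Let B be the set of all families (T_α)_{α∈A} with T_α ∈ P_α B(H) P_α for every α, sup_α ‖T_α‖ < ∞, and such that (T_α) converges in the *-strong operator topology to some T ∈ B(H); let J be the set of those families in B converging to 0 in the *-strong operator topology. Then: B is a closed *-subalgebra of the ℓ∞-product ∏_α P_α B(H) P_α and is a unital C*-algebra with unit (P_α)_α; J is a closed two-sided ideal of B; the map π(( T_α )) = (*-SOT)-lim_α T_α is a well-defined surjective unital *-homomorphism from B onto B(H) with kernel J; and for every T ∈ B(H) the family (P_α T P_α)_α belongs to B and π((P_α T P_α)) = T. -/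
/- STATEMENT 0: Lemma 1 (parts 1-4) of the paper: the algebra `B` of *-SOT convergent
bounded families from corners `Pα B(H) Pα`, the ideal `J` of families converging to `0`,
and the limit map `π`. -/

open Filter Topology

/-- A net (indexed by a directed set `ι`) of operators converges in the *-strong operator
topology to `T₀`. -/
def SOTStarTendsto {H : Type*} [NormedAddCommGroup H] [InnerProductSpace ℂ H]
    [CompleteSpace H] {ι : Type*} [Preorder ι] (T : ι → H →L[ℂ] H) (T₀ : H →L[ℂ] H) : Prop :=
  ∀ x : H, Tendsto (fun i => T i x) atTop (𝓝 (T₀ x)) ∧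
    Tendsto (fun i => star (T i) x) atTop (𝓝 (star T₀ x))

section SOTStar

variable {H : Type*} [NormedAddCommGroup H] [InnerProductSpace ℂ H] {ι : Type*}

/-- Multiplication is jointly continuous for pointwise convergence when the left factor is
bounded. -/
theorem tendsto_apply_of_norm_le {l : Filter ι} {T : ι → H →L[ℂ] H} {T₀ : H →L[ℂ] H} {C : ℝ}
    (hC : ∀ i, ‖T i‖ ≤ C) (hT : ∀ x, Tendsto (fun i => T i x) l (𝓝 (T₀ x)))
    {u : ι → H} {a : H} (hu : Tendsto u l (𝓝 a)) :
    Tendsto (fun i => T i (u i)) l (𝓝 (T₀ a)) := by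
  have h0 : Tendsto (fun i => T i (u i - a)) l (𝓝 0) := by
    have h1 : Tendsto (fun i => C * ‖u i - a‖) l (𝓝 0) := by
      simpa using ((tendsto_iff_norm_sub_tendsto_zero.1 hu).const_mul C)
    exact squeeze_zero_norm (fun i => (T i).le_of_opNorm_le (hC i) _) h1
  simpa using h0.add (hT a)

variable [CompleteSpace H]

/-- A bounded family of operators which is a uniform limit of pointwise convergent families is
pointwise convergent to a bounded operator. -/
theorem exists_tendsto_apply_of_uniform_approx {l : Filter ι} [l.NeBot] {T : ι → H →L[ℂ] H}
    {C : ℝ} (hC : ∀ i, ‖T i‖ ≤ C)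
    (h : ∀ ε : ℝ, 0 < ε → ∃ (S : ι → H →L[ℂ] H) (S₀ : H →L[ℂ] H),
      (∀ x, Tendsto (fun i => S i x) l (𝓝 (S₀ x))) ∧ ∀ i, ‖T i - S i‖ ≤ ε) :
    ∃ T₀ : H →L[ℂ] H, ∀ x, Tendsto (fun i => T i x) l (𝓝 (T₀ x)) := by
  have hlim : ∀ x, ∃ y, Tendsto (fun i => T i x) l (𝓝 y) := by
    intro x
    rw [← cauchy_map_iff_exists_tendsto, Metric.cauchy_iff]
    refine ⟨inferInstance, fun ε hε => ?_⟩
    have hx : 0 < ‖x‖ + 1 := by positivity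
    obtain ⟨S, S₀, hS, hTS⟩ := h (ε / (4 * (‖x‖ + 1))) (by positivity)
    refine ⟨Metric.ball (S₀ x) (ε / 2), ?_, fun y hy z hz => ?_⟩
    · rw [mem_map]
      filter_upwards [Metric.tendsto_nhds.1 (hS x) (ε / 4) (by positivity)] with i hi
      have h1 : ‖T i x - S i x‖ ≤ ε / (4 * (‖x‖ + 1)) * ‖x‖ :=
        (T i - S i).le_of_opNorm_le (hTS i) x
      have h2 : ε / (4 * (‖x‖ + 1)) * ‖x‖ ≤ ε / 4 := by
        rw [div_mul_eq_mul_div, div_le_div_iff₀ (by positivity) (by positivity)]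
        nlinarith
      have h3 := dist_triangle (T i x) (S i x) (S₀ x)
      rw [dist_eq_norm (T i x) (S i x)] at h3
      simp only [Set.mem_preimage, Metric.mem_ball]
      linarith
    · have := dist_triangle_right y z (S₀ x)
      rw [Metric.mem_ball] at hy hz
      linarith
  choose f hf using hlim
  refine ⟨LinearMap.mkContinuous
    { toFun := f
      map_add' := fun x y => tendsto_nhds_unique (hf (x + y)) (by simpa using (hf x).add (hf y))
      map_smul' := fun c x => tendsto_nhds_unique (hf (c • x))
        (by simpa using (hf x).const_smul c) } C fun x => ?_, hf⟩
  exact le_of_tendsto (hf x).norm (Eventually.of_forall fun i => (T i).le_of_opNorm_le (hC i) x)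

variable [Preorder ι] {T S : ι → H →L[ℂ] H} {T₀ S₀ : H →L[ℂ] H}

namespace SOTStarTendsto

theorem star (hT : SOTStarTendsto T T₀) : SOTStarTendsto (fun i => star (T i)) (star T₀) :=
  fun x => ⟨(hT x).2, by simpa using (hT x).1⟩

theorem add (hT : SOTStarTendsto T T₀) (hS : SOTStarTendsto S S₀) :
    SOTStarTendsto (fun i => T i + S i) (T₀ + S₀) :=
  fun x => ⟨by simpa using (hT x).1.add (hS x).1, by simpa using (hT x).2.add (hS x).2⟩

theorem const_smul (c : ℂ) (hT : SOTStarTendsto T T₀) :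
    SOTStarTendsto (fun i => c • T i) (c • T₀) :=
  fun x => ⟨by simpa using (hT x).1.const_smul c, by
    simpa [star_smul] using (hT x).2.const_smul (Star.star c)⟩

theorem mul (hT : SOTStarTendsto T T₀) (hS : SOTStarTendsto S S₀) (hTb : ∃ C : ℝ, ∀ i, ‖T i‖ ≤ C)
    (hSb : ∃ C : ℝ, ∀ i, ‖S i‖ ≤ C) : SOTStarTendsto (fun i => T i * S i) (T₀ * S₀) := by
  obtain ⟨C, hC⟩ := hTb
  obtain ⟨D, hD⟩ := hSb
  refine fun x => ⟨tendsto_apply_of_norm_le hC (fun y => (hT y).1) (hS x).1, ?_⟩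
  simp only [star_mul]
  exact tendsto_apply_of_norm_le (fun i => (norm_star (S i)).trans_le (hD i))
    (fun y => (hS y).2) (hT x).2

theorem const (T₀ : H →L[ℂ] H) : SOTStarTendsto (fun _ : ι => T₀) T₀ :=
  fun _ => ⟨tendsto_const_nhds, tendsto_const_nhds⟩

variable [IsDirectedOrder ι] [Nonempty ι]

theorem unique (hT : SOTStarTendsto T T₀) (hS : SOTStarTendsto T S₀) : T₀ = S₀ :=
  ContinuousLinearMap.ext fun x => tendsto_nhds_unique (hT x).1 (hS x).1

/-- A uniform limit of bounded *-SOT convergent families is *-SOT convergent. -/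
theorem exists_of_uniform_approx {C : ℝ} (hC : ∀ i, ‖T i‖ ≤ C)
    (h : ∀ ε : ℝ, 0 < ε → ∃ (S : ι → H →L[ℂ] H) (S₀ : H →L[ℂ] H),
      SOTStarTendsto S S₀ ∧ ∀ i, ‖T i - S i‖ ≤ ε) :
    ∃ T₀ : H →L[ℂ] H, SOTStarTendsto T T₀ := by
  obtain ⟨T₀, h0⟩ := exists_tendsto_apply_of_uniform_approx (l := atTop) hC fun ε hε => by
    obtain ⟨S, S₀, hS, hd⟩ := h ε hε
    exact ⟨S, S₀, fun x => (hS x).1, hd⟩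
  obtain ⟨T₁, h1⟩ := exists_tendsto_apply_of_uniform_approx (l := atTop)
    (T := fun i => Star.star (T i)) (fun i => (norm_star (T i)).trans_le (hC i)) fun ε hε => by
      obtain ⟨S, S₀, hS, hd⟩ := h ε hε
      refine ⟨fun i => Star.star (S i), Star.star S₀, fun x => (hS x).2, fun i => ?_⟩
      rw [← star_sub, norm_star]
      exact hd i
  have hadj : T₁ = Star.star T₀ := by
    rw [ContinuousLinearMap.star_eq_adjoint, ContinuousLinearMap.eq_adjoint_iff]
    refine fun x y => tendsto_nhds_unique ((h1 x).inner tendsto_const_nhds) ?_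
    simpa [ContinuousLinearMap.star_eq_adjoint, ContinuousLinearMap.adjoint_inner_left] using
      (tendsto_const_nhds (x := x)).inner (𝕜 := ℂ) (h0 y)
  exact ⟨T₀, fun x => ⟨h0 x, hadj ▸ h1 x⟩⟩

/-- A *-SOT convergent family that is a uniform limit of *-SOT null families is null. -/
theorem eq_zero_of_uniform_approx (hT : SOTStarTendsto T T₀)
    (h : ∀ ε : ℝ, 0 < ε → ∃ S : ι → H →L[ℂ] H, SOTStarTendsto S 0 ∧ ∀ i, ‖T i - S i‖ ≤ ε) :
    T₀ = 0 := by
  rw [← norm_le_zero_iff]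
  refine le_of_forall_pos_le_add fun ε hε => ?_
  obtain ⟨S, hS, hd⟩ := h ε hε
  rw [zero_add]
  refine ContinuousLinearMap.opNorm_le_bound _ hε.le fun x => ?_
  have h1 : Tendsto (fun i => T i x - S i x) atTop (𝓝 (T₀ x)) := by
    simpa using (hT x).1.sub (hS x).1
  exact le_of_tendsto h1.norm
    (Eventually.of_forall fun i => (T i - S i).le_of_opNorm_le (hd i) x)

end SOTStarTendsto

end SOTStar

theorem stmt_0 {H : Type*} [NormedAddCommGroup H] [InnerProductSpace ℂ H] [CompleteSpace H]
    {ι : Type*} [SemilatticeSup ι] [Nonempty ι]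
    (P : ι → H →L[ℂ] H)
    (hPproj : ∀ i, IsSelfAdjoint (P i) ∧ P i * P i = P i)
    (hPlim : SOTStarTendsto P (1 : H →L[ℂ] H))
    (B J : Set (ι → (H →L[ℂ] H)))
    (hB : B = {T | (∀ i, P i * T i * P i = T i) ∧ (∃ C : ℝ, ∀ i, ‖T i‖ ≤ C) ∧
                    ∃ T₀ : H →L[ℂ] H, SOTStarTendsto T T₀})
    (hJ : J = {T ∈ B | SOTStarTendsto T (0 : H →L[ℂ] H)}) :
    -- (1) `B` is a closed *-subalgebra of the ℓ∞-product of the corners `Pα B(H) Pα`,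
    --     and a unital C*-algebra whose unit is the family `(Pα)`:
    ((fun i => P i) ∈ B) ∧
    (∀ T S, T ∈ B → S ∈ B → (fun i => T i + S i) ∈ B) ∧
    (∀ T S, T ∈ B → S ∈ B → (fun i => T i * S i) ∈ B) ∧
    (∀ (c : ℂ) T, T ∈ B → (fun i => c • T i) ∈ B) ∧
    (∀ T, T ∈ B → (fun i => star (T i)) ∈ B) ∧
    (∀ T, T ∈ B → ((fun i => P i * T i) = T ∧ (fun i => T i * P i) = T)) ∧
    -- `B` is closed in the ℓ∞-product (uniform limits of members of `B` lying in the
    -- product of the corners belong to `B`):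
    (∀ T : ι → (H →L[ℂ] H), (∀ i, P i * T i * P i = T i) → (∃ C : ℝ, ∀ i, ‖T i‖ ≤ C) →
      (∀ ε : ℝ, 0 < ε → ∃ S ∈ B, ∀ i, ‖T i - S i‖ ≤ ε) → T ∈ B) ∧
    -- (2) `J` is a closed two-sided ideal of `B`:
    (J ⊆ B) ∧
    (∀ T S, T ∈ J → S ∈ J → (fun i => T i + S i) ∈ J) ∧
    (∀ (c : ℂ) T, T ∈ J → (fun i => c • T i) ∈ J) ∧
    (∀ T, T ∈ J → (fun i => star (T i)) ∈ J) ∧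
    (∀ T S, T ∈ B → S ∈ J → ((fun i => T i * S i) ∈ J ∧ (fun i => S i * T i) ∈ J)) ∧
    (∀ T : ι → (H →L[ℂ] H), T ∈ B →
      (∀ ε : ℝ, 0 < ε → ∃ S ∈ J, ∀ i, ‖T i - S i‖ ≤ ε) → T ∈ J) ∧
    -- (3)+(4) the limit map `π` is well defined on `B` (unique limit) ...
    (∀ T, T ∈ B → ∃! T₀ : H →L[ℂ] H, SOTStarTendsto T T₀) ∧
    -- ... and is a unital *-homomorphism:
    (SOTStarTendsto (fun i => P i) (1 : H →L[ℂ] H)) ∧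
    (∀ T S T₀ S₀, T ∈ B → S ∈ B → SOTStarTendsto T T₀ → SOTStarTendsto S S₀ →
      SOTStarTendsto (fun i => T i + S i) (T₀ + S₀) ∧
      SOTStarTendsto (fun i => T i * S i) (T₀ * S₀)) ∧
    (∀ (c : ℂ) T T₀, T ∈ B → SOTStarTendsto T T₀ → SOTStarTendsto (fun i => c • T i) (c • T₀)) ∧
    (∀ T T₀, T ∈ B → SOTStarTendsto T T₀ → SOTStarTendsto (fun i => star (T i)) (star T₀)) ∧
    -- the kernel of `π` is `J`:
    (∀ T, T ∈ B → (SOTStarTendsto T (0 : H →L[ℂ] H) ↔ T ∈ J)) ∧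
    -- `π` is surjective; indeed for every `T₀ ∈ B(H)` the family `(Pα T₀ Pα)` belongs
    -- to `B` and `π((Pα T₀ Pα)) = T₀`:
    (∀ T₀ : H →L[ℂ] H, (fun i => P i * T₀ * P i) ∈ B ∧
      SOTStarTendsto (fun i => P i * T₀ * P i) T₀) := by
  have hleft : ∀ {i} {A : H →L[ℂ] H}, P i * A * P i = A → P i * A = A := fun {i A} h => by
    rw [← h, ← mul_assoc, ← mul_assoc, (hPproj i).2]
  have hright : ∀ {i} {A : H →L[ℂ] H}, P i * A * P i = A → A * P i = A := fun {i A} h => by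
    rw [← h, mul_assoc, (hPproj i).2]
  have hPb : ∃ C : ℝ, ∀ i, ‖P i‖ ≤ C :=
    ⟨1, fun i => IsStarProjection.norm_le (P i) ⟨(hPproj i).2, (hPproj i).1⟩⟩
  have hmulb : ∀ {T S : ι → H →L[ℂ] H}, (∃ C : ℝ, ∀ i, ‖T i‖ ≤ C) → (∃ C : ℝ, ∀ i, ‖S i‖ ≤ C) →
      ∃ C : ℝ, ∀ i, ‖T i * S i‖ ≤ C := by
    rintro T S ⟨C, hC⟩ ⟨D, hD⟩
    exact ⟨C * D, fun i => norm_mul_le_of_le (hC i) (hD i)⟩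
  have memB : ∀ T, T ∈ B ↔ (∀ i, P i * T i * P i = T i) ∧ (∃ C : ℝ, ∀ i, ‖T i‖ ≤ C) ∧
      ∃ T₀ : H →L[ℂ] H, SOTStarTendsto T T₀ := fun T => by rw [hB]; rfl
  have memJ : ∀ T, T ∈ J ↔ T ∈ B ∧ SOTStarTendsto T (0 : H →L[ℂ] H) := fun T => by rw [hJ]; rfl
  clear hB hJ
  have hPB : (fun i => P i) ∈ B :=
    (memB _).2 ⟨fun i => by rw [(hPproj i).2, (hPproj i).2], hPb, 1, hPlim⟩
  have haddB : ∀ T S, T ∈ B → S ∈ B → (fun i => T i + S i) ∈ B := by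
    intro T S hT hS
    obtain ⟨hTP, ⟨C, hC⟩, T₀, hT₀⟩ := (memB T).1 hT
    obtain ⟨hSP, ⟨D, hD⟩, S₀, hS₀⟩ := (memB S).1 hS
    exact (memB _).2 ⟨fun i => by rw [mul_add, add_mul, hTP, hSP],
      ⟨C + D, fun i => norm_add_le_of_le (hC i) (hD i)⟩, _, hT₀.add hS₀⟩
  have hmulB : ∀ T S, T ∈ B → S ∈ B → (fun i => T i * S i) ∈ B := by
    intro T S hT hS
    obtain ⟨hTP, hTb, T₀, hT₀⟩ := (memB T).1 hT
    obtain ⟨hSP, hSb, S₀, hS₀⟩ := (memB S).1 hS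
    exact (memB _).2 ⟨fun i => by rw [← mul_assoc, hleft (hTP i), mul_assoc, hright (hSP i)],
      hmulb hTb hSb, _, hT₀.mul hS₀ hTb hSb⟩
  have hsmulB : ∀ (c : ℂ) T, T ∈ B → (fun i => c • T i) ∈ B := by
    intro c T hT
    obtain ⟨hTP, ⟨C, hC⟩, T₀, hT₀⟩ := (memB T).1 hT
    exact (memB _).2 ⟨fun i => by rw [mul_smul_comm, smul_mul_assoc, hTP],
      ⟨‖c‖ * C, fun i => by rw [norm_smul]; gcongr; exact hC i⟩, _, hT₀.const_smul c⟩
  have hstarB : ∀ T, T ∈ B → (fun i => star (T i)) ∈ B := by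
    intro T hT
    obtain ⟨hTP, ⟨C, hC⟩, T₀, hT₀⟩ := (memB T).1 hT
    refine (memB _).2 ⟨fun i => ?_, ⟨C, fun i => (norm_star (T i)).trans_le (hC i)⟩, _, hT₀.star⟩
    conv_rhs => rw [← hTP i]
    rw [star_mul, star_mul, (hPproj i).1.star_eq, mul_assoc]
  have hbdd : ∀ {T}, T ∈ B → ∃ C : ℝ, ∀ i, ‖T i‖ ≤ C := fun hT => ((memB _).1 hT).2.1
  have hcompr : ∀ T₀ : H →L[ℂ] H, SOTStarTendsto (fun i => P i * T₀ * P i) T₀ := fun T₀ => by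
    have h := (hPlim.mul (.const T₀) hPb ⟨‖T₀‖, fun _ => le_rfl⟩).mul hPlim
      (hmulb hPb ⟨‖T₀‖, fun _ => le_rfl⟩) hPb
    simpa only [one_mul, mul_one] using h
  refine ⟨hPB, haddB, hmulB, hsmulB, hstarB, ?_, ?_, fun T hT => ((memJ T).1 hT).1, ?_, ?_, ?_, ?_,
    ?_, ?_, hPlim, ?_, fun c T T₀ _ hT => hT.const_smul c, fun T T₀ _ hT => hT.star, ?_, ?_⟩
  · intro T hT
    have hTP := ((memB T).1 hT).1
    exact ⟨funext fun i => hleft (hTP i), funext fun i => hright (hTP i)⟩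
  · rintro T hTP ⟨C, hC⟩ h
    refine (memB T).2 ⟨hTP, ⟨C, hC⟩, SOTStarTendsto.exists_of_uniform_approx hC fun ε hε => ?_⟩
    obtain ⟨S, hS, hd⟩ := h ε hε
    obtain ⟨S₀, hS₀⟩ := ((memB S).1 hS).2.2
    exact ⟨S, S₀, hS₀, hd⟩
  · intro T S hT hS
    obtain ⟨hTB, hT0⟩ := (memJ T).1 hT
    obtain ⟨hSB, hS0⟩ := (memJ S).1 hS
    exact (memJ _).2 ⟨haddB T S hTB hSB, by simpa only [add_zero] using hT0.add hS0⟩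
  · intro c T hT
    obtain ⟨hTB, hT0⟩ := (memJ T).1 hT
    exact (memJ _).2 ⟨hsmulB c T hTB, by simpa only [smul_zero] using hT0.const_smul c⟩
  · intro T hT
    obtain ⟨hTB, hT0⟩ := (memJ T).1 hT
    exact (memJ _).2 ⟨hstarB T hTB, by simpa only [star_zero] using hT0.star⟩
  · intro T S hT hS
    obtain ⟨T₀, hT₀⟩ := ((memB T).1 hT).2.2
    obtain ⟨hSB, hS0⟩ := (memJ S).1 hS
    exact ⟨(memJ _).2 ⟨hmulB T S hT hSB, by
        simpa only [mul_zero] using hT₀.mul hS0 (hbdd hT) (hbdd hSB)⟩,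
      (memJ _).2 ⟨hmulB S T hSB hT, by
        simpa only [zero_mul] using hS0.mul hT₀ (hbdd hSB) (hbdd hT)⟩⟩
  · intro T hT h
    obtain ⟨T₀, hT₀⟩ := ((memB T).1 hT).2.2
    have h0 : T₀ = 0 := hT₀.eq_zero_of_uniform_approx fun ε hε => by
      obtain ⟨S, hS, hd⟩ := h ε hε
      exact ⟨S, ((memJ S).1 hS).2, hd⟩
    exact (memJ T).2 ⟨hT, h0 ▸ hT₀⟩
  · intro T hT
    obtain ⟨T₀, hT₀⟩ := ((memB T).1 hT).2.2
    exact ⟨T₀, hT₀, fun S₀ hS₀ => hS₀.unique hT₀⟩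
  · exact fun T S T₀ S₀ hT hS hT₀ hS₀ => ⟨hT₀.add hS₀, hT₀.mul hS₀ (hbdd hT) (hbdd hS)⟩
  · exact fun T hT => ⟨fun h => (memJ T).2 ⟨hT, h⟩, fun h => ((memJ T).1 h).2⟩
  · intro T₀
    refine ⟨(memB _).2 ⟨fun i => ?_, hmulb (hmulb hPb ⟨‖T₀‖, fun _ => le_rfl⟩) hPb, T₀,
      hcompr T₀⟩, hcompr T₀⟩
    rw [mul_assoc, mul_assoc (P i * T₀), (hPproj i).2, ← mul_assoc, ← mul_assoc, (hPproj i).2]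
end

section
/- Every C*-algebra is a *-homomorphic image of an RFD C*-algebra: for every C*-algebra A there exist an RFD C*-algebra B and a surjective *-homomorphism φ : B → A. -/
/- STATEMENT 2: every C*-algebra is a *-homomorphic image of an RFD C*-algebra. -/

universe u

/-- A C*-algebra is residually finite-dimensional (RFD) if its representations on
finite-dimensional complex Hilbert spaces separate its points. -/
def IsRFD (A : Type u) [NonUnitalCStarAlgebra A] : Prop :=
  ∀ a : A, a ≠ 0 →
    ∃ (H : Type u) (_ : NormedAddCommGroup H) (_ : InnerProductSpace ℂ H)
      (_ : FiniteDimensional ℂ H) (π : A →⋆ₙₐ[ℂ] (H →L[ℂ] H)), π a ≠ 0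

open Filter Topology ContinuousLinearMap
open scoped ENNReal ComplexOrder ComplexStarModule

/-- A uniformly bounded family of additive maps converges pointwise to zero on a closed set. -/
theorem isClosed_tendsto_zero_of_bound {ι V W : Type*} [SeminormedAddCommGroup V]
    [SeminormedAddCommGroup W] {l : Filter ι} (L : ι → V →+ W) (C : ℝ)
    (hL : ∀ i v, ‖L i v‖ ≤ C * ‖v‖) : IsClosed {v | Tendsto (fun i => L i v) l (𝓝 0)} := by
  refine isClosed_of_closure_subset fun v hv => ?_
  rw [Set.mem_ofPred_eq, Metric.tendsto_nhds]
  intro ε hε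
  have hC : 0 < |C| + 1 := by positivity
  obtain ⟨w, hw, hvw⟩ := Metric.mem_closure_iff.1 hv (ε / 2 / (|C| + 1)) (by positivity)
  filter_upwards [Metric.tendsto_nhds.1 hw (ε / 2) (by positivity)] with i hi
  rw [dist_zero_right] at hi ⊢
  have h1 : ‖L i (v - w)‖ < ε / 2 := by
    rw [dist_eq_norm, lt_div_iff₀ hC] at hvw
    refine (hL i _).trans_lt (lt_of_le_of_lt ?_ hvw)
    rw [mul_comm]
    gcongr
    linarith [le_abs_self C]
  calc ‖L i v‖ = ‖L i (v - w) + L i w‖ := by rw [← map_add, sub_add_cancel]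
    _ ≤ ‖L i (v - w)‖ + ‖L i w‖ := norm_add_le _ _
    _ < ε := by linarith

section Compression

variable {E : Type*} [NormedAddCommGroup E] [InnerProductSpace ℂ E]

/-- The finite-dimensional subspace spanned by a finite set of vectors. -/
abbrev finsetSpan (s : Finset E) : Submodule ℂ E := Submodule.span ℂ (s : Set E)

variable (K : Submodule ℂ E) [K.HasOrthogonalProjection]

/-- Extension of an operator on a subspace by zero on the orthogonal complement. -/
noncomputable def extendByZero : (K →L[ℂ] K) →ₙₐ[ℂ] (E →L[ℂ] E) where
  toFun T := K.subtypeL ∘L T ∘L K.orthogonalProjectionOnto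
  map_smul' c T := by ext; simp
  map_zero' := by ext; simp
  map_add' S T := by ext; simp
  map_mul' S T := by ext; simp

theorem extendByZero_apply (T : K →L[ℂ] K) (x : E) :
    extendByZero K T x = T (K.orthogonalProjectionOnto x) := rfl

theorem norm_extendByZero_apply_le (T : K →L[ℂ] K) (x : E) :
    ‖extendByZero K T x‖ ≤ ‖T‖ * ‖x‖ := by
  rw [extendByZero_apply, ← Submodule.coe_norm]
  refine (T.le_opNorm _).trans ?_
  gcongr
  exact K.norm_orthogonalProjectionOnto_apply_le x

/-- Compression of an operator to a subspace. -/
noncomputable def compression (T : E →L[ℂ] E) : K →L[ℂ] K :=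
  K.orthogonalProjectionOnto ∘L T ∘L K.subtypeL

theorem norm_compression_le (T : E →L[ℂ] E) : ‖compression K T‖ ≤ ‖T‖ := by
  refine opNorm_le_bound _ (norm_nonneg _) fun x => ?_
  exact (K.norm_orthogonalProjectionOnto_apply_le _).trans (T.le_opNorm _)

theorem star_compression [CompleteSpace E] [CompleteSpace K] (T : E →L[ℂ] E) :
    star (compression K T) = compression K (star T) := by
  rw [star_eq_adjoint, star_eq_adjoint, eq_comm, eq_adjoint_iff]
  intro x y
  simp [compression, adjoint_inner_left]

theorem tendsto_extendByZero_compression (T : E →L[ℂ] E) (x : E) :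
    Tendsto (fun s : Finset E => extendByZero (finsetSpan s) (compression (finsetSpan s) T) x)
      atTop (𝓝 (T x)) := by
  classical
  refine tendsto_const_nhds.congr' ?_
  filter_upwards [eventually_ge_atTop {x, T x}] with s hs
  have hx : x ∈ finsetSpan s := Submodule.subset_span (hs (by simp))
  have hTx : T x ∈ finsetSpan s := Submodule.subset_span (hs (by simp))
  have h1 : ((finsetSpan s).orthogonalProjectionOnto x : E) = x :=
    Submodule.starProjection_eq_self_iff.2 hx
  have h2 : ((finsetSpan s).orthogonalProjectionOnto (T x) : E) = T x :=
    Submodule.starProjection_eq_self_iff.2 hTx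
  simp [extendByZero_apply, compression, h1, h2]

end Compression

section Cover

universe v

variable {A J : Type*} [NonUnitalCStarAlgebra A] {H : J → Type v}
  [∀ j, NormedAddCommGroup (H j)] [∀ j, InnerProductSpace ℂ (H j)]

/-- The C⋆-algebra of operators on the span of a finite set of vectors. -/
def FinsetOperators {E : Type*} [NormedAddCommGroup E] [InnerProductSpace ℂ E]
    (s : Finset E) : Type _ :=
  finsetSpan s →L[ℂ] finsetSpan s

noncomputable instance {E : Type*} [NormedAddCommGroup E] [InnerProductSpace ℂ E]
    (s : Finset E) : NonUnitalCStarAlgebra (FinsetOperators s) :=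
  inferInstanceAs (NonUnitalCStarAlgebra (finsetSpan s →L[ℂ] finsetSpan s))

variable (H) in
/-- The bounded families of operators on the finite-dimensional subspaces `finsetSpan s` of the
Hilbert spaces `H j`. -/
def BoundedFamilies : Type _ :=
  lp (fun i : Σ j, Finset (H j) => FinsetOperators i.2) ∞

noncomputable instance : NonUnitalCStarAlgebra (BoundedFamilies H) :=
  inferInstanceAs <| NonUnitalCStarAlgebra
    (lp (fun i : Σ j, Finset (H j) => FinsetOperators i.2) ∞)

/-- The component of a bounded family at a finite set of vectors. -/
noncomputable def BoundedFamilies.component (j : J) (s : Finset (H j)) :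
    BoundedFamilies H →⋆ₙₐ[ℂ] (finsetSpan s →L[ℂ] finsetSpan s) where
  toFun T := T.1 ⟨j, s⟩
  map_smul' _ _ := rfl
  map_zero' := rfl
  map_add' _ _ := rfl
  map_mul' _ _ := rfl
  map_star' _ := rfl

theorem BoundedFamilies.norm_component_le (j : J) (s : Finset (H j)) (T : BoundedFamilies H) :
    ‖T.component j s‖ ≤ ‖T‖ :=
  lp.norm_apply_le_norm ENNReal.top_ne_zero T ⟨j, s⟩

/-- The component of a bounded family, as an operator on the whole Hilbert space. -/
noncomputable def BoundedFamilies.extend (j : J) (s : Finset (H j)) :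
    BoundedFamilies H →ₙₐ[ℂ] (H j →L[ℂ] H j) :=
  (extendByZero (finsetSpan s)).comp
    (NonUnitalAlgHomClass.toNonUnitalAlgHom (BoundedFamilies.component j s))

theorem BoundedFamilies.norm_extend_apply_le (j : J) (s : Finset (H j)) (T : BoundedFamilies H)
    (x : H j) : ‖T.extend j s x‖ ≤ ‖T‖ * ‖x‖ := by
  refine (norm_extendByZero_apply_le _ _ _).trans ?_
  gcongr
  exact T.norm_component_le j s

variable [∀ j, CompleteSpace (H j)] (π : ∀ j, A →⋆ₙₐ[ℂ] (H j →L[ℂ] H j))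

/-- The family `p.1` converges to the representing operators of `p.2` strongly. -/
def StronglyConverges (p : BoundedFamilies H × A) : Prop :=
  ∀ j x, Tendsto (fun s => p.1.extend j s x) atTop (𝓝 (π j p.2 x))

variable {π}

theorem StronglyConverges.add {p q : BoundedFamilies H × A} (hp : StronglyConverges π p)
    (hq : StronglyConverges π q) : StronglyConverges π (p + q) := fun j x => by
  simpa using (hp j x).add (hq j x)

theorem StronglyConverges.smul {p : BoundedFamilies H × A} (hp : StronglyConverges π p) (c : ℂ) :
    StronglyConverges π (c • p) := fun j x => by
  simpa using (hp j x).const_smul c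

theorem StronglyConverges.zero : StronglyConverges π 0 := fun j x => by
  simp

theorem StronglyConverges.mul {p q : BoundedFamilies H × A} (hp : StronglyConverges π p)
    (hq : StronglyConverges π q) : StronglyConverges π (p * q) := fun j x => by
  have hsmall : Tendsto (fun s => p.1.extend j s (q.1.extend j s x - π j q.2 x)) atTop (𝓝 0) := by
    refine squeeze_zero_norm (a := fun s => ‖p.1‖ * ‖q.1.extend j s x - π j q.2 x‖)
      (fun s => p.1.norm_extend_apply_le j s _) ?_
    simpa using (tendsto_iff_norm_sub_tendsto_zero.1 (hq j x)).const_mul ‖p.1‖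
  simpa using hsmall.add (hp j (π j q.2 x))

variable (π)

theorem isClosed_stronglyConverges :
    IsClosed {p : BoundedFamilies H × A | StronglyConverges π p} := by
  simp only [StronglyConverges, Set.ofPred_forall]
  refine isClosed_iInter fun j => isClosed_iInter fun x => ?_
  let L (s : Finset (H j)) : BoundedFamilies H × A →+ H j :=
    { toFun p := p.1.extend j s x - π j p.2 x
      map_zero' := by simp
      map_add' p q := by simp; abel }
  convert! isClosed_tendsto_zero_of_bound (l := atTop) L (2 * ‖x‖) fun s p => ?_ using 3
  · exact tendsto_sub_nhds_zero_iff.symm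
  · calc ‖L s p‖ ≤ ‖p.1.extend j s x‖ + ‖π j p.2 x‖ := norm_sub_le _ _
      _ ≤ ‖p‖ * ‖x‖ + ‖p‖ * ‖x‖ := by
        gcongr
        · refine (p.1.norm_extend_apply_le j s x).trans ?_
          gcongr
          exact norm_fst_le p
        · refine ((π j p.2).le_opNorm x).trans ?_
          gcongr
          exact (NonUnitalStarAlgHom.norm_apply_le (π j) p.2).trans (norm_snd_le p)
      _ = 2 * ‖x‖ * ‖p‖ := by ring

/-- The pairs `(T, a)` where the family `T` converges to the operators representing `a` in the
strong-star topology. -/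
noncomputable def strongStarCover : NonUnitalStarSubalgebra ℂ (BoundedFamilies H × A) where
  carrier := {p | StronglyConverges π p ∧ StronglyConverges π (star p)}
  add_mem' hp hq := ⟨hp.1.add hq.1, by rw [star_add]; exact hp.2.add hq.2⟩
  zero_mem' := ⟨.zero, by rw [star_zero]; exact .zero⟩
  mul_mem' hp hq := ⟨hp.1.mul hq.1, by rw [star_mul]; exact hq.2.mul hp.2⟩
  smul_mem' c p hp := ⟨hp.1.smul c, by rw [star_smul]; exact hp.2.smul _⟩
  star_mem' hp := ⟨hp.2, by rw [star_star]; exact hp.1⟩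

theorem isClosed_strongStarCover :
    IsClosed (strongStarCover π : Set (BoundedFamilies H × A)) :=
  (isClosed_stronglyConverges π).inter ((isClosed_stronglyConverges π).preimage continuous_star)

theorem exists_mem_strongStarCover (a : A) : ∃ T, (T, a) ∈ strongStarCover π := by
  let T : BoundedFamilies H := ⟨fun i => compression (finsetSpan i.2) (π i.1 a), by
    refine memℓp_infty ⟨‖a‖, ?_⟩
    rintro _ ⟨i, rfl⟩
    exact (norm_compression_le _ _).trans (NonUnitalStarAlgHom.norm_apply_le (π i.1) a)⟩
  refine ⟨T, fun j x => tendsto_extendByZero_compression (π j a) x, fun j x => ?_⟩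
  have h := tendsto_extendByZero_compression (π j (star a)) x
  rw [map_star] at h
  simp only [← star_compression] at h
  rw [← map_star] at h
  exact h

/-- A pair in `strongStarCover π` whose first component vanishes is zero if `π` is faithful. -/
theorem eq_zero_of_mem_strongStarCover (hπ : ∀ a, (∀ j, π j a = 0) → a = 0)
    {p : BoundedFamilies H × A} (hp : p ∈ strongStarCover π)
    (h : ∀ j s, p.1.component j s = 0) : p = 0 := by
  have h0 : p.1 = 0 := lp.ext (funext fun i => h i.1 i.2)
  refine Prod.ext h0 (hπ _ fun j => ?_)
  ext x
  have := hp.1 j x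
  simp only [h0, map_zero, zero_apply] at this
  exact tendsto_nhds_unique this tendsto_const_nhds

end Cover

section States

variable {A : Type*} [NonUnitalCStarAlgebra A] [PartialOrder A] [StarOrderedRing A]

/-- Positive functionals detect nonzero positive elements. -/
theorem exists_positiveLinearMap_apply_ne_zero {b : A} (hb : 0 ≤ b) (hb0 : b ≠ 0) :
    ∃ f : A →ₚ[ℂ] ℂ, f b ≠ 0 := by
  have hnb : -b ∉ ProperCone.positive ℝ A := fun h =>
    hb0 (le_antisymm (neg_nonneg.1 (ProperCone.mem_positive.1 h)) hb)
  obtain ⟨f, hf, hfb⟩ := (ProperCone.positive ℝ A).hyperplane_separation_point hnb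
  let g : A →ₗ[ℂ] ℂ :=
    { toFun x := f (ℜ x : A) + Complex.I * f (ℑ x : A)
      map_add' x y := by simp; ring
      map_smul' c x := by
        apply Complex.ext <;> simp [realPart_smul, imaginaryPart_smul] }
  have hg {x : A} (hx : 0 ≤ x) : g x = f x := by
    have hx' : IsSelfAdjoint x := .of_nonneg hx
    simp [g, hx'.coe_realPart, hx'.imaginaryPart]
  refine ⟨.mk₀ g fun x hx => ?_, ?_⟩
  · rw [hg hx]
    exact_mod_cast hf x hx
  · change g b ≠ 0
    rw [hg hb]
    simp only [map_neg] at hfb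
    exact_mod_cast (neg_neg_iff_pos.1 hfb).ne'

/-- The GNS representations separate the points of a C⋆-algebra. -/
theorem eq_zero_of_forall_gns_eq_zero {a : A}
    (h : ∀ f : A →ₚ[ℂ] ℂ, f.gnsNonUnitalStarAlgHom a = 0) : a = 0 := by
  by_contra ha
  have hb : star (a * star a) * (a * star a) ≠ 0 := by
    rwa [Ne, CStarRing.star_mul_self_eq_zero_iff, CStarRing.mul_star_self_eq_zero_iff]
  obtain ⟨f, hf⟩ := exists_positiveLinearMap_apply_ne_zero (star_mul_self_nonneg _) hb
  apply hf
  have h0 : f.leftMulMapPreGNS a (f.toPreGNS (star a)) = f.toPreGNS (a * star a) := by simp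
  have h1 : ‖f.toPreGNS (a * star a)‖ = 0 := by
    rw [← h0, ← UniformSpace.Completion.norm_coe, ← f.gnsNonUnitalStarAlgHom_apply_coe, h f]
    simp
  have h2 := f.preGNS_norm_sq (f.toPreGNS (a * star a))
  rw [h1] at h2
  simpa using h2.symm

end States

/-- If finite-dimensional representations of a C⋆-algebra separate the points of a closed star
subalgebra from zero, then the subalgebra is residually finite-dimensional. -/
theorem isRFD_of_isClosed {C : Type u} [NonUnitalCStarAlgebra C] (S : NonUnitalStarSubalgebra ℂ C)
    [IsClosed (S : Set C)]
    (h : ∀ c ∈ S, c ≠ 0 → ∃ (H : Type u) (_ : NormedAddCommGroup H) (_ : InnerProductSpace ℂ H)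
      (_ : FiniteDimensional ℂ H) (π : C →⋆ₙₐ[ℂ] (H →L[ℂ] H)), π c ≠ 0) :
    IsRFD S := fun c hc => by
  obtain ⟨H, _, _, _, π, hπ⟩ := h c c.2 fun h => hc (Subtype.ext h)
  exact ⟨H, _, _, inferInstance, π.comp (NonUnitalStarSubalgebraClass.subtype S), hπ⟩

theorem stmt_2 (A : Type u) [NonUnitalCStarAlgebra A] :
    ∃ (B : Type u) (_ : NonUnitalCStarAlgebra B) (φ : B →⋆ₙₐ[ℂ] A),
      IsRFD B ∧ Function.Surjective φ := by
  let _ := CStarAlgebra.spectralOrder A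
  have _ := CStarAlgebra.spectralOrderedRing A
  let π (f : A →ₚ[ℂ] ℂ) := f.gnsNonUnitalStarAlgHom
  have hπ (a : A) (h : ∀ f, π f a = 0) : a = 0 := eq_zero_of_forall_gns_eq_zero h
  have hclosed := isClosed_strongStarCover π
  refine ⟨strongStarCover π, NonUnitalStarSubalgebra.nonUnitalCStarAlgebra _,
    (NonUnitalStarAlgHom.snd ℂ (BoundedFamilies _) A).comp
      (NonUnitalStarSubalgebraClass.subtype (strongStarCover π)),
    isRFD_of_isClosed _ fun p hp hp0 => ?_, fun a => ?_⟩
  · obtain ⟨f, s, hs⟩ : ∃ f s, p.1.component f s ≠ 0 := by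
      by_contra! h
      exact hp0 (eq_zero_of_mem_strongStarCover π hπ hp h)
    exact ⟨finsetSpan s, inferInstance, inferInstance, inferInstance,
      (BoundedFamilies.component (H := fun f : A →ₚ[ℂ] ℂ => f.GNS) f s).comp
        (NonUnitalStarAlgHom.fst ℂ _ A), hs⟩
  · obtain ⟨T, hT⟩ := exists_mem_strongStarCover π a
    exact ⟨⟨_, hT⟩, rfl⟩
end

section
/- Suppose k and m are cardinals with ℵ₀ ≤ k ≤ m, and A is an m-generated C*-algebra that is R_{<k}D. Then there exist an index set Λ with card Λ = m, a family (X_λ)_{λ∈Λ} of nonzero complex Hilbert spaces with Hilbert dimension dim X_λ < k for every λ, and unital *-homomorphisms π_λ : A⁺ → B(X_λ), such that the family (π_λ) separates the points of A⁺ (for every nonzero a ∈ A⁺ there is λ with π_λ(a) ≠ 0), and moreover for every λ₀ ∈ Λ the set { λ ∈ Λ : π_λ is unitarily equivalent to π_{λ₀} } has cardinality m. -/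
/- STATEMENT 3: Lemma 2 part (1). -/

open Cardinal

universe u

/-- A C*-algebra `A` is `R_{<k}D` if its representations on complex Hilbert spaces of
Hilbert dimension (cardinality of an orthonormal basis) strictly less than `k` separate
the points of `A`. -/
def IsRltkD (k : Cardinal.{u}) (A : Type u) [NonUnitalCStarAlgebra A] : Prop :=
  ∀ a : A, a ≠ 0 →
    ∃ (H : Type u) (_ : NormedAddCommGroup H) (_ : InnerProductSpace ℂ H)
      (_ : CompleteSpace H) (ι : Type u) (_ : HilbertBasis ι ℂ H)
      (π : A →⋆ₙₐ[ℂ] (H →L[ℂ] H)), #ι < k ∧ π a ≠ 0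

/-- A C*-algebra is `m`-generated if it is generated, as a C*-algebra (i.e. topologically),
by a set of cardinality at most `m`. -/
def MGenerated (m : Cardinal.{u}) (A : Type u) [NonUnitalCStarAlgebra A] : Prop :=
  ∃ G : Set A, #G ≤ m ∧ (NonUnitalStarAlgebra.adjoin ℂ G).topologicalClosure = ⊤

/-- A (unital) representation of the unitization `A⁺` on a complex Hilbert space. -/
structure HilbertRep (A : Type u) [NonUnitalCStarAlgebra A] : Type (u + 1) where
  carrier : Type u
  [nacg : NormedAddCommGroup carrier]
  [ips : InnerProductSpace ℂ carrier]
  [complete : CompleteSpace carrier]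
  hom : Unitization ℂ A →⋆ₐ[ℂ] (carrier →L[ℂ] carrier)

attribute [instance] HilbertRep.nacg HilbertRep.ips HilbertRep.complete

/-- The Hilbert dimension of the representation space is strictly less than `k`. -/
def HilbertRep.dimLt {A : Type u} [NonUnitalCStarAlgebra A] (r : HilbertRep A)
    (k : Cardinal.{u}) : Prop :=
  ∃ (ι : Type u) (_ : HilbertBasis ι ℂ r.carrier), #ι < k

/-- Unitary equivalence of two representations. -/
def HilbertRep.UEquiv {A : Type u} [NonUnitalCStarAlgebra A] (r s : HilbertRep A) : Prop :=
  ∃ V : r.carrier ≃ₗᵢ[ℂ] s.carrier, ∀ (a : Unitization ℂ A) (x : r.carrier),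
    V (r.hom a x) = s.hom a (V x)

/-- In a pseudometric space with a dense subset of cardinality at most `m`, every family of open
sets has a subfamily of cardinality at most `m` with the same union. -/
theorem exists_open_subfamily_of_dense {X : Type u} [PseudoMetricSpace X] {m : Cardinal.{u}}
    (hm : ℵ₀ ≤ m) {D : Set X} (hD : Dense D) (hDm : #D ≤ m) {ι : Type*} (U : ι → Set X)
    (hU : ∀ i, IsOpen (U i)) :
    ∃ (κ : Type u) (f : κ → ι), #κ ≤ m ∧ ∀ x i, x ∈ U i → ∃ j, x ∈ U (f j) := by
  let κ := {p : D × ℕ // ∃ i, Metric.ball (p.1 : X) (1 / (p.2 + 1)) ⊆ U i}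
  refine ⟨κ, fun p => p.2.choose, ?_, fun x i hx => ?_⟩
  · calc #κ ≤ #(D × ℕ) := mk_subtype_le _
      _ = #D * ℵ₀ := by simp
      _ ≤ m * m := mul_le_mul' hDm hm
      _ = m := mul_eq_self hm
  · obtain ⟨ε, hε, hball⟩ := Metric.isOpen_iff.mp (hU i) x hx
    obtain ⟨n, hn⟩ := exists_nat_one_div_lt (half_pos hε)
    obtain ⟨d, hd, hxd⟩ := hD.exists_dist_lt x (Nat.one_div_pos_of_nat (α := ℝ) (n := n))
    have hex : ∃ i, Metric.ball d (1 / ((n : ℝ) + 1)) ⊆ U i := by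
      refine ⟨i, fun y hy => hball ?_⟩
      rw [Metric.mem_ball] at hy ⊢
      linarith [dist_triangle y d x, dist_comm x d]
    exact ⟨⟨(⟨d, hd⟩, n), hex⟩, hex.choose_spec hxd⟩

/-- The unitization of an `m`-generated C*-algebra has a dense subset of cardinality at
most `m`. -/
theorem MGenerated.exists_dense_unitization {m : Cardinal.{u}} (hm : ℵ₀ ≤ m)
    {A : Type u} [NonUnitalCStarAlgebra A] (hgen : MGenerated m A) :
    ∃ D : Set (Unitization ℂ A), Dense D ∧ #D ≤ m := by
  obtain ⟨G, hG, htop⟩ := hgen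
  let Q : Set (Unitization ℂ A) :=
    Set.range fun n : ℕ => Unitization.inl (TopologicalSpace.denseSeq ℂ n)
  let T : Set (Unitization ℂ A) := Q ∪ Unitization.inr '' (G ∪ star G)
  let B := Algebra.adjoin ℤ T
  have hinl (c : ℂ) : (Unitization.inl c : Unitization ℂ A) ∈ B.topologicalClosure := by
    have hcont : Continuous (Unitization.inl : ℂ → Unitization ℂ A) :=
      continuous_algebraMap ℂ (Unitization ℂ A)
    refine map_mem_closure hcont (TopologicalSpace.denseRange_denseSeq ℂ c) ?_
    rintro _ ⟨n, rfl⟩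
    exact Algebra.subset_adjoin (Or.inl ⟨n, rfl⟩)
  have hcontr : Continuous (Unitization.inr : A → Unitization ℂ A) :=
    (Unitization.isometry_inr (𝕜 := ℂ) (A := A)).continuous
  have hadj (a : A) (ha : a ∈ NonUnitalAlgebra.adjoin ℂ (G ∪ star G)) :
      (Unitization.inr a : Unitization ℂ A) ∈ B.topologicalClosure := by
    induction ha using NonUnitalAlgebra.adjoin_induction with
    | mem x hx => exact B.le_topologicalClosure (Algebra.subset_adjoin (Or.inr ⟨x, hx, rfl⟩))
    | add x y _ _ hx hy => rw [Unitization.inr_add]; exact add_mem hx hy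
    | zero => rw [Unitization.inr_zero]; exact zero_mem _
    | mul x y _ _ hx hy => rw [Unitization.inr_mul]; exact mul_mem hx hy
    | smul c x _ hx => rw [← Unitization.inl_mul_inr]; exact mul_mem (hinl c) hx
  have hinr (a : A) : (Unitization.inr a : Unitization ℂ A) ∈ B.topologicalClosure := by
    have ha : a ∈ (NonUnitalStarAlgebra.adjoin ℂ G).topologicalClosure := htop ▸ trivial
    exact closure_minimal (s := (NonUnitalStarAlgebra.adjoin ℂ G : Set A)) hadj
      (B.isClosed_topologicalClosure.preimage hcontr) ha
  refine ⟨B, fun x => ?_, ?_⟩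
  · rw [← Unitization.inl_fst_add_inr_snd_eq x]
    exact add_mem (hinl _) (hinr _)
  · have hstar : #(star G : Set A) ≤ m := by
      rw [← Set.image_star]
      exact mk_image_le.trans hG
    have hQ : #Q ≤ m := (mk_le_aleph0_iff.mpr (Set.countable_range _).to_subtype).trans hm
    have hunion : #(G ∪ star G : Set A) ≤ m :=
      (mk_union_le _ _).trans (add_le_of_le hm hG hstar)
    have hT : #T ≤ m :=
      (mk_union_le _ _).trans (add_le_of_le hm hQ (mk_image_le.trans hunion))
    have hB := Algebra.lift_cardinalMk_adjoin_le ℤ T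
    rw [lift_id'.{0, u}] at hB
    refine hB.trans ?_
    simp [hm, hT]

namespace HilbertRep

variable {A : Type u} [NonUnitalCStarAlgebra A]

theorem UEquiv.refl (r : HilbertRep A) : r.UEquiv r :=
  ⟨LinearIsometryEquiv.refl ℂ r.carrier, fun _ _ => rfl⟩

theorem continuous_hom (r : HilbertRep A) : Continuous r.hom := by
  open scoped CStarAlgebra in exact map_continuous r.hom

/-- The extension to the unitization of a representation of `A`. -/
noncomputable def ofNonUnital {H : Type u} [NormedAddCommGroup H] [InnerProductSpace ℂ H] [CompleteSpace H]
    (π : A →⋆ₙₐ[ℂ] (H →L[ℂ] H)) : HilbertRep A where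
  carrier := H
  hom := Unitization.starLift π

theorem ofNonUnital_hom_apply {H : Type u} [NormedAddCommGroup H] [InnerProductSpace ℂ H]
    [CompleteSpace H] (π : A →⋆ₙₐ[ℂ] (H →L[ℂ] H)) (a : Unitization ℂ A) :
    (ofNonUnital π).hom a = algebraMap ℂ (H →L[ℂ] H) a.fst + π a.snd :=
  rfl

theorem exists_ne_zero_of_hom_ne_zero {r : HilbertRep A} {a : Unitization ℂ A}
    (h : r.hom a ≠ 0) : ∃ x : r.carrier, x ≠ 0 := by
  by_contra! hx
  exact h (ContinuousLinearMap.ext fun x => hx _)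

end HilbertRep

/-- If `A` is `R_{<k}D` with `k` infinite, then so is its unitization, by unital
representations. -/
theorem IsRltkD.exists_hilbertRep {k : Cardinal.{u}} (hk : ℵ₀ ≤ k) {A : Type u}
    [NonUnitalCStarAlgebra A] (hA : IsRltkD k A) {a : Unitization ℂ A} (ha : a ≠ 0) :
    ∃ r : HilbertRep A, r.dimLt k ∧ r.hom a ≠ 0 := by
  by_cases hfst : a.fst = 0
  · have hsnd : a.snd ≠ 0 := fun h => ha (Unitization.ext hfst h)
    obtain ⟨H, _, _, _, ι, b, π, hι, hπ⟩ := hA _ hsnd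
    refine ⟨.ofNonUnital π, ⟨ι, b, hι⟩, ?_⟩
    rwa [HilbertRep.ofNonUnital_hom_apply, hfst, map_zero, zero_add]
  · let H := EuclideanSpace ℂ PUnit.{u + 1}
    refine ⟨.ofNonUnital (0 : A →⋆ₙₐ[ℂ] (H →L[ℂ] H)),
      ⟨PUnit, (EuclideanSpace.basisFun PUnit ℂ).toHilbertBasis, ?_⟩, ?_⟩
    · exact (lt_aleph0_of_finite _).trans_le hk
    · rw [HilbertRep.ofNonUnital_hom_apply, NonUnitalStarAlgHom.zero_apply, add_zero]
      exact (map_ne_zero_iff _ (algebraMap ℂ (H →L[ℂ] H)).injective).mpr hfst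

theorem stmt_3 (k m : Cardinal.{u}) (hk : ℵ₀ ≤ k) (hkm : k ≤ m)
    (A : Type u) [NonUnitalCStarAlgebra A]
    (hgen : MGenerated m A) (hRkD : IsRltkD k A) :
    ∃ (Λ : Type u) (r : Λ → HilbertRep A),
      #Λ = m ∧
      (∀ l : Λ, ∃ x : (r l).carrier, x ≠ 0) ∧
      (∀ l : Λ, (r l).dimLt k) ∧
      (∀ a : Unitization ℂ A, a ≠ 0 → ∃ l : Λ, (r l).hom a ≠ 0) ∧
      (∀ l₀ : Λ, #{l : Λ // (r l).UEquiv (r l₀)} = m) := by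
  have hm : ℵ₀ ≤ m := hk.trans hkm
  obtain ⟨D, hD, hDm⟩ := hgen.exists_dense_unitization hm
  obtain ⟨κ, f, hκ, hf⟩ := exists_open_subfamily_of_dense hm hD hDm
    (fun r : {r : HilbertRep A // r.dimLt k ∧ ∃ x : r.carrier, x ≠ 0} => {a | r.1.hom a ≠ 0})
    (fun r => isOpen_ne_fun r.1.continuous_hom continuous_const)
  have hsep (a : Unitization ℂ A) (ha : a ≠ 0) : ∃ j, (f j).1.hom a ≠ 0 := by
    obtain ⟨r, hr, hra⟩ := hRkD.exists_hilbertRep hk ha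
    exact hf a ⟨r, hr, HilbertRep.exists_ne_zero_of_hom_ne_zero hra⟩ hra
  have hne : #κ ≠ 0 := by
    obtain ⟨j, -⟩ := hsep 1 one_ne_zero
    exact mk_ne_zero_iff.mpr ⟨j⟩
  have hcard : #(κ × m.out) = m := by
    rw [← mul_def, mk_out]
    exact mul_eq_right hm hκ hne
  refine ⟨κ × m.out, fun l => (f l.1).1, hcard, fun l => (f l.1).2.2, fun l => (f l.1).2.1,
    fun a ha => ?_, fun l₀ => le_antisymm ((mk_subtype_le _).trans hcard.le) ?_⟩
  · obtain ⟨j, hj⟩ := hsep a ha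
    obtain ⟨t⟩ : Nonempty m.out := mk_ne_zero_iff.mp (by
      rw [mk_out]
      exact (aleph0_pos.trans_le hm).ne')
    exact ⟨(j, t), hj⟩
  · calc m = #m.out := (mk_out m).symm
      _ ≤ _ := mk_le_of_injective
        (f := fun t => ⟨(l₀.1, t), HilbertRep.UEquiv.refl (f l₀.1).1⟩)
        fun s t hst => (Prod.ext_iff.mp (Subtype.ext_iff.mp hst)).2
end

section
/- Suppose k ≤ m are infinite cardinals, A is a C*-algebra, Λ is an index set with card Λ = m, (X_λ)_{λ∈Λ} are nonzero complex Hilbert spaces with dim X_λ < k, and π_λ : A⁺ → B(X_λ) are unital *-homomorphisms that separate the points of A⁺ and such that for every λ₀ ∈ Λ the set { λ : π_λ unitarily equivalent to π_{λ₀} } has cardinality m. Let H = ⨁_{λ∈Λ} X_λ (Hilbert space direct sum, so dim H = m) and let π = ⨁_λ π_λ : A⁺ → B(H) be the direct sum representation. Then for every unital *-homomorphism ρ : A⁺ → B(H), every ε > 0, every finite subset W ⊆ A⁺ and every finite subset E ⊆ H, there is a finite subset F ⊆ Λ such that for every finite set G with F ⊆ G ⊆ Λ, letting Q_G denote the orthogonal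 projection of H onto ⨁_{λ∈G} X_λ, there exists an operator U ∈ B(H) with U*U = UU* = Q_G such that ‖(ρ(a) − U* π(a) U) e‖ < ε for every a ∈ W and every e ∈ E. -/
/- STATEMENT 5: Lemma 3, the approximation lemma. -/

open Cardinal

universe u

/-- A self-adjoint `h` is positive as soon as no nonzero `star d * d` has the form `-(c * h * c)`
with `c` self-adjoint. -/
lemma exists_eq_star_mul_self_of_forall {B : Type*} [CStarAlgebra B] (h : B)
    (hsa : IsSelfAdjoint h)
    (H : ∀ c d : B, star c = c → star d * d = -(c * h * c) → d = 0) : ∃ t, h = star t * t := by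
  let _ := CStarAlgebra.spectralOrder B
  have := CStarAlgebra.spectralOrderedRing B
  set c := h⁻ with hc
  have hc0 : 0 ≤ c := CFC.negPart_nonneg h
  have hcsa : star c = c := hc0.isSelfAdjoint
  have hchc : c * h * c = -(c * c * c) := by
    conv_lhs => rw [← CFC.posPart_sub_negPart h hsa]
    rw [mul_sub, CFC.negPart_mul_posPart, zero_sub, neg_mul]
  obtain ⟨s, hs⟩ := CStarAlgebra.nonneg_iff_eq_star_mul_self.mp hc0
  have hd : star (s * c) * (s * c) = c * c * c := by
    rw [star_mul, hcsa, mul_assoc, ← mul_assoc (star s), ← hs, mul_assoc]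
  have hsc : s * c = 0 := H c _ hcsa (by rw [hd, hchc, neg_neg])
  have h3 : c * c * c = 0 := by rw [← hd, hsc, mul_zero]
  have h4 : c * c = 0 := by
    rw [← CStarRing.star_mul_self_eq_zero_iff, star_mul, hcsa, ← mul_assoc, h3, zero_mul]
  have hc00 : c = 0 := by rwa [← CStarRing.star_mul_self_eq_zero_iff, hcsa]
  exact CStarAlgebra.nonneg_iff_eq_star_mul_self.mp ((CFC.negPart_eq_zero_iff h hsa).mp hc00)

section MatrixAction

variable {𝒜 ι X : Type*} [CStarAlgebra 𝒜] [Fintype ι]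
  [NormedAddCommGroup X] [InnerProductSpace ℂ X] [CompleteSpace X]

/-- The action of matrices over `𝒜` on tuples of vectors induced by a representation of `𝒜`. -/
noncomputable def matrixAct (φ : 𝒜 →⋆ₐ[ℂ] (X →L[ℂ] X)) (M : CStarMatrix ι ι 𝒜) (f : ι → X) : ι → X :=
  fun i => ∑ j, φ (M i j) (f j)

lemma matrixAct_mul (φ : 𝒜 →⋆ₐ[ℂ] (X →L[ℂ] X)) (M N : CStarMatrix ι ι 𝒜) (f : ι → X) :
    matrixAct φ (M * N) f = matrixAct φ M (matrixAct φ N f) := by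
  ext i
  simp only [matrixAct, CStarMatrix.mul_apply, map_sum, map_mul, _root_.sum_apply,
    mul_apply_eq_comp]
  exact Finset.sum_comm

lemma sum_inner_matrixAct_star (φ : 𝒜 →⋆ₐ[ℂ] (X →L[ℂ] X)) (M : CStarMatrix ι ι 𝒜)
    (f g : ι → X) :
    ∑ i, inner ℂ (f i) (matrixAct φ (star M) g i) = ∑ i, inner ℂ (matrixAct φ M f i) (g i) := by
  simp only [matrixAct, CStarMatrix.star_apply, map_star, inner_sum, sum_inner,
    ContinuousLinearMap.star_eq_adjoint, ContinuousLinearMap.adjoint_inner_right]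
  exact Finset.sum_comm

lemma sum_inner_matrixAct_star_mul_self (φ : 𝒜 →⋆ₐ[ℂ] (X →L[ℂ] X)) (M : CStarMatrix ι ι 𝒜)
    (f : ι → X) :
    ∑ i, inner ℂ (f i) (matrixAct φ (star M * M) f i) =
      ((∑ i, ‖matrixAct φ M f i‖ ^ 2 : ℝ) : ℂ) := by
  rw [matrixAct_mul, sum_inner_matrixAct_star]
  push_cast
  exact Finset.sum_congr rfl fun i _ => inner_self_eq_norm_sq_to_K _

lemma re_sum_inner_matrixAct_add_star (φ : 𝒜 →⋆ₐ[ℂ] (X →L[ℂ] X)) (M : CStarMatrix ι ι 𝒜)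
    (f : ι → X) :
    (∑ i, inner ℂ (f i) (matrixAct φ (M + star M) f i)).re =
      2 * (∑ i, inner ℂ (f i) (matrixAct φ M f i)).re := by
  have h : ∑ i, inner ℂ (f i) (matrixAct φ (M + star M) f i) =
      ∑ i, inner ℂ (f i) (matrixAct φ M f i) + ∑ i, inner ℂ (f i) (matrixAct φ (star M) f i) := by
    simp [matrixAct, Finset.sum_add_distrib]
  rw [h, sum_inner_matrixAct_star, Complex.add_re, two_mul, Complex.re_sum, Complex.re_sum]
  congr 1
  exact Finset.sum_congr rfl fun i _ => inner_re_symm (𝕜 := ℂ) _ _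

lemma eq_zero_of_matrixAct_eq_zero {Λ : Type*} {Y : Λ → Type*} [DecidableEq ι]
    [∀ l, NormedAddCommGroup (Y l)] [∀ l, InnerProductSpace ℂ (Y l)] [∀ l, CompleteSpace (Y l)]
    (φ : ∀ l, 𝒜 →⋆ₐ[ℂ] (Y l →L[ℂ] Y l)) (hφ : ∀ a, a ≠ 0 → ∃ l, φ l a ≠ 0)
    (M : CStarMatrix ι ι 𝒜) (h : ∀ l f i, matrixAct (φ l) M f i = 0) : M = 0 := by
  ext i j
  by_contra hne
  obtain ⟨l, hl⟩ := hφ _ hne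
  refine hl (ContinuousLinearMap.ext fun x => ?_)
  have := h l (Pi.single j x) i
  rw [matrixAct, Finset.sum_eq_single j] at this
  · simpa using this
  · intro k _ hk
    simp [hk]
  · simp

/-- A matrix over `𝒜` whose quadratic form has nonnegative real part in each member of a
separating family of representations has this property in every representation. -/
lemma re_sum_inner_matrixAct_nonneg {Λ : Type*} {Y : Λ → Type*}
    [∀ l, NormedAddCommGroup (Y l)] [∀ l, InnerProductSpace ℂ (Y l)] [∀ l, CompleteSpace (Y l)]
    (φ : ∀ l, 𝒜 →⋆ₐ[ℂ] (Y l →L[ℂ] Y l)) (hφ : ∀ a, a ≠ 0 → ∃ l, φ l a ≠ 0)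
    (M : CStarMatrix ι ι 𝒜)
    (hM : ∀ l f, 0 ≤ (∑ i, inner ℂ (f i) (matrixAct (φ l) M f i)).re)
    (ρ : 𝒜 →⋆ₐ[ℂ] (X →L[ℂ] X)) (e : ι → X) :
    0 ≤ (∑ i, inner ℂ (e i) (matrixAct ρ M e i)).re := by
  classical
  let _ := CStarAlgebra.spectralOrder 𝒜
  have := CStarAlgebra.spectralOrderedRing 𝒜
  set h : CStarMatrix ι ι 𝒜 := M + star M with hh
  have hsa : IsSelfAdjoint h := IsSelfAdjoint.add_star_self M
  have hh0 : ∀ l f, 0 ≤ (∑ i, inner ℂ (f i) (matrixAct (φ l) h f i)).re := fun l f => by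
    rw [hh, re_sum_inner_matrixAct_add_star]
    linarith [hM l f]
  obtain ⟨t, ht⟩ := exists_eq_star_mul_self_of_forall h hsa fun c d hcsa hd => by
    refine eq_zero_of_matrixAct_eq_zero φ hφ _ fun l f i => ?_
    have h1 := hh0 l (matrixAct (φ l) c f)
    rw [← sum_inner_matrixAct_star, hcsa, ← matrixAct_mul, ← matrixAct_mul] at h1
    have h2 : matrixAct (φ l) (c * h * c) f = - matrixAct (φ l) (star d * d) f := by
      rw [hd]
      ext i
      simp [matrixAct]
    have h3 := sum_inner_matrixAct_star_mul_self (φ l) d f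
    rw [h2] at h1
    simp only [Pi.neg_apply, inner_neg_right, Finset.sum_neg_distrib] at h1
    rw [h3, Complex.neg_re, Complex.ofReal_re] at h1
    have h4 : ∑ i, ‖matrixAct (φ l) d f i‖ ^ 2 = 0 := le_antisymm (by linarith) (by positivity)
    rw [Finset.sum_eq_zero_iff_of_nonneg fun i _ => by positivity] at h4
    simpa using h4 i (Finset.mem_univ i)
  have h2 := re_sum_inner_matrixAct_add_star ρ M e
  rw [← hh, ht, sum_inner_matrixAct_star_mul_self, Complex.ofReal_re] at h2
  have : 0 ≤ ∑ i, ‖matrixAct ρ t e i‖ ^ 2 := by positivity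
  linarith

end MatrixAction

/-- The matrix over `𝒜` representing a linear functional on families of moments. -/
noncomputable def functionalMatrix {𝒜 ι κ : Type*} [CStarAlgebra 𝒜] [Fintype κ] [DecidableEq ι]
    [DecidableEq κ] (c : κ → 𝒜) (g : StrongDual ℂ (κ × ι × ι → ℂ)) : CStarMatrix ι ι 𝒜 :=
  CStarMatrix.ofMatrix fun i j => ∑ k, g (Pi.single (k, i, j) 1) • c k

lemma sum_inner_matrixAct_neg_functionalMatrix {𝒜 ι κ X : Type*} [CStarAlgebra 𝒜] [Fintype ι]
    [Fintype κ] [DecidableEq ι] [DecidableEq κ]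
    [NormedAddCommGroup X] [InnerProductSpace ℂ X] [CompleteSpace X]
    (φ : 𝒜 →⋆ₐ[ℂ] (X →L[ℂ] X)) (c : κ → 𝒜) (g : StrongDual ℂ (κ × ι × ι → ℂ)) (f : ι → X) :
    ∑ i, inner ℂ (f i) (matrixAct φ (-functionalMatrix c g) f i) =
      -g (fun q => inner ℂ (f q.2.1) (φ (c q.1) (f q.2.2))) := by
  have hg (z : κ × ι × ι → ℂ) : g z = ∑ k, ∑ i, ∑ j, z (k, i, j) * g (Pi.single (k, i, j) 1) := by
    conv_lhs => rw [← Finset.univ_sum_single z, map_sum]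
    simp only [Fintype.sum_prod_type]
    refine Finset.sum_congr rfl fun k _ => Finset.sum_congr rfl fun i _ =>
      Finset.sum_congr rfl fun j _ => ?_
    rw [← smul_eq_mul, ← map_smul, ← Pi.single_smul, smul_eq_mul, mul_one]
  have hM (i j : ι) : functionalMatrix c g i j = ∑ k, g (Pi.single (k, i, j) 1) • c k := rfl
  rw [hg]
  simp only [matrixAct, CStarMatrix.neg_apply, hM, map_neg, map_sum, map_smul, neg_apply,
    sum_apply, smul_apply, Finset.sum_neg_distrib, inner_neg_right, inner_sum, inner_smul_right,
    neg_inj]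
  rw [Finset.sum_comm (s := (Finset.univ : Finset κ))]
  refine Finset.sum_congr rfl fun i _ => ?_
  rw [Finset.sum_comm (s := (Finset.univ : Finset κ))]
  exact Finset.sum_congr rfl fun j _ => Finset.sum_congr rfl fun k _ => mul_comm _ _

/-- A neighbourhood of a complex matrix contains all matrices with uniformly close entries. -/
lemma exists_forall_entry_lt_imp_mem_of_mem_nhds {m n : Type*} [Fintype m] [Fintype n]
    {M : Matrix m n ℂ} {O : Set (Matrix m n ℂ)} (hO : O ∈ nhds M) :
    ∃ δ > 0, ∀ P : Matrix m n ℂ, (∀ i j, ‖P i j - M i j‖ < δ) → P ∈ O := by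
  obtain ⟨δ, hδ, h⟩ := (Metric.mem_nhds_iff (α := m → n → ℂ)).mp hO
  refine ⟨δ, hδ, fun P hP => h ?_⟩
  have hd : dist (fun i j => P i j) (fun i j => M i j) < δ :=
    (dist_pi_lt_iff hδ).mpr fun i => (dist_pi_lt_iff hδ).mpr fun j =>
      (dist_eq_norm (P i j) (M i j)).trans_lt (hP i j)
  exact hd

/-- The moments of a finite tuple of vectors under an arbitrary representation are approximated by
finite sums of moments of tuples of vectors under the members of a separating family. -/
lemma exists_sum_inner_approx {𝒜 Λ ι κ K : Type*} {Y : Λ → Type*} [CStarAlgebra 𝒜]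
    [Fintype ι] [Fintype κ] [Nonempty Λ]
    [∀ l, NormedAddCommGroup (Y l)] [∀ l, InnerProductSpace ℂ (Y l)] [∀ l, CompleteSpace (Y l)]
    [NormedAddCommGroup K] [InnerProductSpace ℂ K] [CompleteSpace K]
    (φ : ∀ l, 𝒜 →⋆ₐ[ℂ] (Y l →L[ℂ] Y l)) (hφ : ∀ a, a ≠ 0 → ∃ l, φ l a ≠ 0)
    (ρ : 𝒜 →⋆ₐ[ℂ] (K →L[ℂ] K)) (c : κ → 𝒜) (e : ι → K) {δ : ℝ} (hδ : 0 < δ) :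
    ∃ (T : Type) (_ : Fintype T) (l : T → Λ) (f : ∀ t, ι → Y (l t)),
      ∀ k i j, ‖∑ t, inner ℂ (f t i) (φ (l t) (c k) (f t j)) - inner ℂ (e i) (ρ (c k) (e j))‖ < δ := by
  classical
  let mom : (l : Λ) → (ι → Y l) → (κ × ι × ι → ℂ) :=
    fun l f q => inner ℂ (f q.2.1) (φ l (c q.1) (f q.2.2))
  let S : Set (κ × ι × ι → ℂ) := {z | ∃ l f, mom l f = z}
  let p : κ × ι × ι → ℂ := fun q => inner ℂ (e q.2.1) (ρ (c q.1) (e q.2.2))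
  have hsmul : ∀ (w : ℝ), 0 ≤ w → ∀ l f, w • mom l f = mom l (fun i => (√w : ℂ) • f i) := by
    intro w hw l f
    ext q
    have : ((√w : ℂ)) * (√w : ℂ) = (w : ℂ) := by
      rw [← Complex.ofReal_mul, Real.mul_self_sqrt hw]
    simp [mom, ← mul_assoc, this]
  have hp : p ∈ closure (convexHull ℝ S) := by
    by_contra hp
    obtain ⟨g, u, hg, hgp⟩ := RCLike.geometric_hahn_banach_closed_point (𝕜 := ℂ)
      (convex_convexHull ℝ S).closure isClosed_closure hp
    replace hg : ∀ l f, (g (mom l f)).re < u := fun l f =>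
      hg _ (subset_closure (subset_convexHull ℝ S ⟨l, f, rfl⟩))
    have hg0 : ∀ l f, (g (mom l f)).re ≤ 0 := by
      intro l f
      by_contra! hpos
      have h1 := hg l (fun i => (√(|u| / (g (mom l f)).re) : ℂ) • f i)
      rw [← hsmul _ (by positivity), ← Complex.coe_smul, map_smul, smul_eq_mul,
        Complex.re_ofReal_mul, div_mul_cancel₀ _ hpos.ne'] at h1
      exact absurd (le_abs_self u) (not_le.mpr h1)
    have hu : 0 < u := by
      have h1 := hg (Classical.arbitrary Λ) 0
      have h2 : mom (Classical.arbitrary Λ) 0 = 0 := by ext q; simp [mom]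
      simpa [h2] using h1
    have h1 := re_sum_inner_matrixAct_nonneg φ hφ (-functionalMatrix c g)
      (fun l f => by
        rw [sum_inner_matrixAct_neg_functionalMatrix, Complex.neg_re]
        exact neg_nonneg.mpr (hg0 l f)) ρ e
    rw [sum_inner_matrixAct_neg_functionalMatrix, Complex.neg_re] at h1
    have h2 : u < (g p).re := hgp
    have h3 : 0 ≤ -(g p).re := h1
    linarith
  obtain ⟨z, hz, hzp⟩ := Metric.mem_closure_iff.mp hp δ hδ
  obtain ⟨T, _, w, y, hw, -, hy, rfl⟩ := mem_convexHull_iff_exists_fintype.mp hz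
  choose l f hf using hy
  refine ⟨T, inferInstance, l, fun t i => (√(w t) : ℂ) • f t i, fun k i j => ?_⟩
  rw [dist_comm, dist_eq_norm] at hzp
  refine lt_of_le_of_lt ?_ ((norm_le_pi_norm _ (k, i, j)).trans_lt hzp)
  simp only [← hf, hsmul _ (hw _)]
  simp [mom, p]

section Orthonormalization

open Topology Filter

variable {H : Type*} [NormedAddCommGroup H] [InnerProductSpace ℂ H]

/-- Almost orthonormal tuples are close to orthonormal tuples in their span. -/
lemma exists_orthonormal_near (d : ℕ) {η : ℝ} (hη : 0 < η) :
    ∃ δ > 0, ∀ v : Fin d → H, (∀ i j, ‖inner ℂ (v i) (v j) - if i = j then 1 else 0‖ < δ) →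
      ∃ w : Fin d → H, Orthonormal ℂ w ∧ (∀ i, ‖v i - w i‖ < η) ∧
        ∀ i, w i ∈ Submodule.span ℂ (Set.range v) := by
  induction d generalizing η with
  | zero => exact ⟨1, one_pos, fun v _ => ⟨v, by simp [Orthonormal], by simp, by simp⟩⟩
  | succ d ih =>
    set θ : ℝ := min η 1 / (6 * d + 2) with hθ
    have hθ0 : 0 < θ := by positivity
    have hθη : (6 * d + 2) * θ = min η 1 := by rw [hθ]; field_simp
    obtain ⟨δ, hδ, h⟩ := ih hθ0
    refine ⟨min δ θ, by positivity, fun v hv => ?_⟩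
    obtain ⟨w, hw, hwv, hwspan⟩ := h (fun i => v i.succ) fun i j => by
      simpa [Fin.succ_inj] using (hv i.succ j.succ).trans_le (min_le_left _ _)
    have hd : (0 : ℝ) ≤ d := d.cast_nonneg
    have hθ1 : (6 * d + 2) * θ ≤ 1 := hθη.trans_le (min_le_right _ _)
    have hθη' : (6 * d + 2) * θ ≤ η := hθη.trans_le (min_le_left _ _)
    have hdθ : 0 ≤ d * θ := by positivity
    have hnorm : |‖v 0‖ - 1| ≤ θ := by
      have h1 := ((hv 0 0).trans_le (min_le_right _ _)).le
      rw [if_pos rfl, inner_self_eq_norm_sq_to_K] at h1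
      have h2 : |‖v 0‖ ^ 2 - 1| ≤ θ := by
        rw [← Real.norm_eq_abs, ← Complex.norm_real]
        simpa using h1
      have h3 : ‖v 0‖ ^ 2 - 1 = (‖v 0‖ - 1) * (‖v 0‖ + 1) := by ring
      rw [h3, abs_mul] at h2
      have h4 : (1 : ℝ) ≤ |‖v 0‖ + 1| := by
        rw [abs_of_nonneg (by positivity)]
        linarith [norm_nonneg (v 0)]
      nlinarith [abs_nonneg (‖v 0‖ - 1)]
    have hv0 : ‖v 0‖ ≤ 2 := by linarith [(abs_le.mp hnorm).2]
    have hin : ∀ i, ‖inner ℂ (w i) (v 0)‖ ≤ 3 * θ := fun i => by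
      have h1 := ((hv i.succ 0).trans_le (min_le_right _ _)).le
      rw [if_neg (Fin.succ_ne_zero i), sub_zero] at h1
      have h2 : inner ℂ (w i) (v 0) = inner ℂ (v i.succ) (v 0) - inner ℂ (v i.succ - w i) (v 0) := by
        rw [inner_sub_left]; ring
      have h3 := norm_inner_le_norm (𝕜 := ℂ) (v i.succ - w i) (v 0)
      rw [h2]
      refine (norm_sub_le _ _).trans ?_
      nlinarith [hwv i, norm_nonneg (v i.succ - w i), norm_nonneg (v 0)]
    set t : H := v 0 - ∑ i, inner ℂ (w i) (v 0) • w i with ht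
    have htv : ‖v 0 - t‖ ≤ 3 * d * θ := by
      rw [ht, sub_sub_cancel]
      refine (norm_sum_le _ _).trans ((Finset.sum_le_card_nsmul _ _ (3 * θ) fun i _ => ?_).trans ?_)
      · rw [norm_smul, hw.1 i, mul_one]; exact hin i
      · simp; linarith
    have htnorm : |‖t‖ - 1| ≤ (3 * d + 1) * θ := by
      have h1 := abs_norm_sub_norm_le (v 0) t
      rw [abs_le] at h1 hnorm ⊢
      constructor <;> linarith
    have ht0 : 0 < ‖t‖ := by
      have := (abs_le.mp htnorm).1
      linarith
    have htw : ∀ i, inner ℂ t (w i) = 0 := fun i => by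
      rw [ht, inner_sub_left, sum_inner]
      simp [inner_smul_left, orthonormal_iff_ite.mp hw]
    have hscale : ‖t - (‖t‖⁻¹ : ℂ) • t‖ = |‖t‖ - 1| := by
      have : t - (‖t‖⁻¹ : ℂ) • t = ((1 - ‖t‖⁻¹ : ℝ) : ℂ) • t := by
        push_cast; rw [sub_smul, one_smul]
      rw [this, norm_smul, Complex.norm_real, Real.norm_eq_abs, ← abs_of_pos ht0, ← abs_mul,
        abs_of_pos ht0, sub_mul, inv_mul_cancel₀ ht0.ne', one_mul]
    refine ⟨Matrix.vecCons ((‖t‖⁻¹ : ℂ) • t) w, ?_, ?_, ?_⟩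
    · refine orthonormal_vecCons_iff.mpr ⟨?_, fun i => ?_, hw⟩
      · rw [norm_smul]
        simp [ht0.ne']
      · rw [inner_smul_left, htw, mul_zero]
    · refine Fin.cases ?_ fun i => ?_
      · rw [Matrix.cons_val_zero]
        refine (norm_sub_le_norm_sub_add_norm_sub _ t _).trans_lt ?_
        rw [hscale]
        nlinarith
      · rw [Matrix.cons_val_succ]
        refine (hwv i).trans_le ?_
        nlinarith
    · have hsub : ∀ i, w i ∈ Submodule.span ℂ (Set.range v) := fun i =>
        Submodule.span_mono (by rintro _ ⟨j, rfl⟩; exact ⟨j.succ, rfl⟩) (hwspan i)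
      refine Fin.cases ?_ fun i => ?_
      · exact Submodule.smul_mem _ _ (Submodule.sub_mem _ (Submodule.subset_span ⟨0, rfl⟩)
          (Submodule.sum_mem _ fun i _ => Submodule.smul_mem _ _ (hsub i)))
      · exact hsub i

/-- Tuples with nearby Gram matrices are, up to a small error, given by the same coordinates with
respect to suitable orthonormal tuples. -/
lemma exists_coordinates_of_gram_near {S : Type*} [Fintype S] (x : S → H) {η : ℝ} (hη : 0 < η) :
    ∃ (d : ℕ) (D : S → Fin d → ℂ), ∀ᶠ P in 𝓝 (Matrix.gram ℂ x), ∀ y : S → H,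
      Matrix.gram ℂ y = P →
      ∃ w : Fin d → H, Orthonormal ℂ w ∧ (∀ i, w i ∈ Submodule.span ℂ (Set.range y)) ∧
        ∀ s, ‖y s - ∑ i, D s i • w i‖ < η := by
  classical
  have : FiniteDimensional ℂ (Submodule.span ℂ (Set.range x)) :=
    FiniteDimensional.span_of_finite ℂ (Set.finite_range x)
  let u := stdOrthonormalBasis ℂ (Submodule.span ℂ (Set.range x))
  have hC : ∀ i, ∃ C : S → ℂ, ∑ s, C s • x s = u i := fun i =>
    (Submodule.mem_span_range_iff_exists_fun ℂ).mp (u i).2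
  choose C hC using hC
  let D : S → Fin _ → ℂ := fun s i => inner ℂ (u i : H) (x s)
  have hD : ∀ s, x s = ∑ i, D s i • (u i : H) := fun s => by
    have h1 := u.sum_repr' ⟨x s, Submodule.subset_span ⟨s, rfl⟩⟩
    simpa [D] using (congrArg Subtype.val h1).symm
  obtain ⟨B, hB0, hB⟩ : ∃ B : ℝ, 0 < B ∧ ∀ s, ∑ i, ‖D s i‖ ≤ B :=
    ⟨∑ s, ∑ i, ‖D s i‖ + 1, by positivity, fun s =>
      (Finset.single_le_sum (f := fun s => ∑ i, ‖D s i‖) (fun _ _ => by positivity)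
        (Finset.mem_univ s)).trans (by linarith)⟩
  obtain ⟨δ, hδ, hnear⟩ := exists_orthonormal_near (H := H) _ (η := η / (2 * B)) (by positivity)
  let q : (S → ℂ) → (S → ℂ) → Matrix S S ℂ → ℂ := fun a b P =>
    ∑ s, ∑ t, star (a s) * b t * P s t
  have hq : ∀ a b (y : S → H),
      inner ℂ (∑ s, a s • y s) (∑ s, b s • y s) = q a b (Matrix.gram ℂ y) := by
    intro a b y
    simp only [q, sum_inner]
    refine Finset.sum_congr rfl fun s _ => ?_
    rw [inner_sum]
    refine Finset.sum_congr rfl fun t _ => ?_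
    simp [inner_smul_left, inner_smul_right, mul_assoc, mul_left_comm]
  have hqc : ∀ a b, Continuous (q a b) := by
    intro a b
    fun_prop
  let z : S → S → ℂ := fun s => Pi.single s 1 - ∑ i, D s i • C i
  have hz : ∀ s (y : S → H), ∑ t, z s t • y t = y s - ∑ i, D s i • ∑ t, C i t • y t := by
    intro s y
    simp only [z, Pi.sub_apply, sub_smul, Finset.sum_sub_distrib, Finset.sum_apply, Pi.smul_apply,
      smul_eq_mul, Finset.sum_smul, Finset.smul_sum, mul_smul]
    rw [Finset.sum_comm]
    simp [Pi.single_apply]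
  have e1 : ∀ᶠ P in 𝓝 (Matrix.gram ℂ x), ∀ i j,
      ‖q (C i) (C j) P - if i = j then 1 else 0‖ < δ := by
    refine eventually_all.mpr fun i => eventually_all.mpr fun j => ?_
    refine ((hqc (C i) (C j)).sub continuous_const).norm.continuousAt.eventually_lt_const ?_
    change ‖q (C i) (C j) (Matrix.gram ℂ x) - if i = j then 1 else 0‖ < δ
    rw [← hq, hC, hC, ← Submodule.coe_inner, orthonormal_iff_ite.mp u.orthonormal, sub_self,
      norm_zero]
    exact hδ
  have e2 : ∀ᶠ P in 𝓝 (Matrix.gram ℂ x), ∀ s, ‖q (z s) (z s) P‖ < (η / 2) ^ 2 := by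
    refine eventually_all.mpr fun s => (hqc (z s) (z s)).norm.continuousAt.eventually_lt_const ?_
    have h0 : ∑ t, z s t • x t = 0 := by
      rw [hz, sub_eq_zero, hD s]
      exact Finset.sum_congr rfl fun i _ => by rw [hC]
    change ‖q (z s) (z s) (Matrix.gram ℂ x)‖ < _
    rw [← hq, h0, inner_zero_left, norm_zero]
    positivity
  refine ⟨_, D, ?_⟩
  filter_upwards [e1, e2] with P h1 h2 y hy
  subst hy
  obtain ⟨w, hw, hwv, hwspan⟩ := hnear (fun i => ∑ s, C i s • y s) fun i j => by
    rw [hq]; exact h1 i j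
  refine ⟨w, hw, fun i => ?_, fun s => ?_⟩
  · refine Submodule.span_le.mpr ?_ (hwspan i)
    rintro _ ⟨j, rfl⟩
    exact Submodule.sum_mem _ fun s _ => Submodule.smul_mem _ _ (Submodule.subset_span ⟨s, rfl⟩)
  · have h3 := h2 s
    rw [← hq, hz, inner_self_eq_norm_sq_to_K] at h3
    replace h3 : ‖y s - ∑ i, D s i • ∑ t, C i t • y t‖ < η / 2 :=
      lt_of_pow_lt_pow_left₀ 2 (by positivity) (by simpa using h3)
    have h4 : ‖∑ i, D s i • ∑ t, C i t • y t - ∑ i, D s i • w i‖ ≤ η / 2 := by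
      rw [← Finset.sum_sub_distrib]
      calc _ ≤ ∑ i, ‖D s i‖ * (η / (2 * B)) := by
            refine norm_sum_le_of_le _ fun i _ => ?_
            rw [← smul_sub, norm_smul]
            exact mul_le_mul_of_nonneg_left (hwv i).le (norm_nonneg _)
        _ ≤ B * (η / (2 * B)) := by
            rw [← Finset.sum_mul]
            exact mul_le_mul_of_nonneg_right (hB s) (by positivity)
        _ = η / 2 := by field_simp
    refine (norm_sub_le_norm_sub_add_norm_sub _ (∑ i, D s i • ∑ t, C i t • y t) _).trans_lt ?_
    linarith

/-- Two orthonormal tuples in the range of a projection are related by a unitary of its corner. -/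
lemma exists_corner_unitary [CompleteSpace H] (Q : H →L[ℂ] H) (hQs : star Q = Q) (hQQ : Q * Q = Q)
    {d : ℕ} {u w : Fin d → H} (hu : Orthonormal ℂ u) (hw : Orthonormal ℂ w)
    (hQu : ∀ i, Q (u i) = u i) (hQw : ∀ i, Q (w i) = w i) :
    ∃ U : H →L[ℂ] H, star U * U = Q ∧ U * star U = Q ∧ ∀ i, U (u i) = w i := by
  classical
  let N := Submodule.span ℂ (Set.range u ∪ Set.range w)
  have : FiniteDimensional ℂ N :=
    FiniteDimensional.span_of_finite ℂ ((Set.finite_range u).union (Set.finite_range w))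
  have hext : ∀ v : Fin d → H, Orthonormal ℂ v → (∀ i, v i ∈ N) →
      ∃ (h : d ≤ Module.finrank ℂ N) (b : OrthonormalBasis (Fin (Module.finrank ℂ N)) ℂ N),
        ∀ i, (b (Fin.castLE h i) : H) = v i := by
    intro v hv hvN
    let v' : Fin d → N := fun i => ⟨v i, hvN i⟩
    have hv' : Orthonormal ℂ v' := by
      rw [orthonormal_iff_ite] at hv ⊢
      exact hv
    have hd : d ≤ Module.finrank ℂ N := by
      simpa using hv'.linearIndependent.fintype_card_le_finrank
    let v'' : Fin (Module.finrank ℂ N) → N := fun j => if h : j < d then v' ⟨j, h⟩ else 0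
    have hv'' : Orthonormal ℂ (Set.domRestrict {j : Fin (Module.finrank ℂ N) | (j : ℕ) < d} v'') := by
      have hinj : Function.Injective
          (fun j : {j : Fin (Module.finrank ℂ N) | (j : ℕ) < d} => (⟨j.1.1, j.2⟩ : Fin d)) :=
        fun j k hjk => Subtype.ext (Fin.ext (by simpa using hjk))
      convert hv'.comp _ hinj using 1
      ext j
      have hj : (j.1 : ℕ) < d := j.2
      simp [v'', hj]
    obtain ⟨b, hb⟩ := hv''.exists_orthonormalBasis_extension_of_card_eq (by simp)
    refine ⟨hd, b, fun i => ?_⟩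
    rw [hb _ (by simp)]
    simp [v'', v']
  obtain ⟨hd, b, hb⟩ := hext u hu fun i => Submodule.subset_span (Or.inl ⟨i, rfl⟩)
  obtain ⟨_, b', hb'⟩ := hext w hw fun i => Submodule.subset_span (Or.inr ⟨i, rfl⟩)
  let V : N ≃ₗᵢ[ℂ] N := b.equiv b' (Equiv.refl _)
  let P : H →L[ℂ] H := N.starProjection
  let T : H →L[ℂ] H := N.subtypeL ∘L (V : N →L[ℂ] N) ∘L N.orthogonalProjectionOnto
  have hTa : ∀ x, T x = V (N.orthogonalProjectionOnto x) := fun x => rfl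
  have hTs : ∀ x, star T x = V.symm (N.orthogonalProjectionOnto x) := fun x => by
    have : star T = N.subtypeL ∘L (V.symm : N →L[ℂ] N) ∘L N.orthogonalProjectionOnto := by
      rw [ContinuousLinearMap.star_eq_adjoint]
      simp only [T, ContinuousLinearMap.adjoint_comp, Submodule.adjoint_subtypeL,
        Submodule.adjoint_orthogonalProjectionOnto]
      rw [ContinuousLinearMap.comp_assoc]
      congr 2
      exact V.adjoint_eq_symm
    rw [this]
    rfl
  have hPa : ∀ x, P x = N.orthogonalProjectionOnto x := fun x => rfl
  have hπ : ∀ x : N, N.orthogonalProjectionOnto (x : H) = x :=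
    Submodule.orthogonalProjectionOnto_mem_subspace_eq_self
  have hQN : ∀ x : N, Q x = x := by
    have : N ≤ (Q - 1 : H →L[ℂ] H).ker := by
      refine Submodule.span_le.mpr ?_
      rintro _ (⟨i, rfl⟩ | ⟨i, rfl⟩)
      · simp [hQu]
      · simp [hQw]
    intro x
    have := this x.2
    simpa [sub_eq_zero] using this
  have hPs : star P = P := isSelfAdjoint_starProjection N
  have hPP : P * P = P := by
    ext x
    change P (P x) = P x
    rw [hPa, hPa, hπ]
  have hQP : Q * P = P := by
    ext x
    change Q (P x) = P x
    rw [hPa, hQN]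
  have hPQ : P * Q = P := by rw [← hPs, ← hQs, ← star_mul, hQP]
  have hQT : Q * T = T := by ext x; simp [hTa, hQN]
  have hPT : P * T = T := by ext x; simp [hTa, hPa, hπ]
  have hQT' : Q * star T = star T := by ext x; simp [hTs, hQN]
  have hPT' : P * star T = star T := by ext x; simp [hTs, hPa, hπ]
  have hTQ : T * Q = T := by rw [← star_star (T * Q), star_mul, hQs, hQT', star_star]
  have hTP : T * P = T := by rw [← star_star (T * P), star_mul, hPs, hPT', star_star]
  have hTQ' : star T * Q = star T := by rw [← hQs, ← star_mul, hQT]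
  have hTP' : star T * P = star T := by rw [← hPs, ← star_mul, hPT]
  have hTT : star T * T = P := by ext x; simp [hTs, hTa, hPa, hπ]
  have hTT' : T * star T = P := by ext x; simp [hTs, hTa, hPa, hπ]
  have hUs : star (T + Q - P) = star T + Q - P := by rw [star_sub, star_add, hQs, hPs]
  refine ⟨T + Q - P, ?_, ?_, fun i => ?_⟩
  · rw [hUs]
    simp only [mul_sub, sub_mul, mul_add, add_mul, hTT, hTQ', hTP', hQT, hQQ, hQP, hPT, hPQ, hPP]
    abel
  · rw [hUs]
    simp only [mul_sub, sub_mul, mul_add, add_mul, hTT', hTQ, hTP, hQT', hQQ, hQP, hPT', hPQ, hPP]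
    abel
  · have h1 : T (u i) = w i := by
      rw [hTa, ← hb i, hπ, ← hb' i]
      simp [V]
    have h2 : P (u i) = u i := by rw [hPa, ← hb i, hπ]
    simp [h1, h2, hQu]

end Orthonormalization

section CornerApproximation

open Topology Filter

variable {H : Type*} [NormedAddCommGroup H] [InnerProductSpace ℂ H] [CompleteSpace H]

/-- If two tuples in the range of a projection have Gram matrices close to a given one, then a
unitary of the corner maps one approximately to the other. -/
lemma exists_corner_unitary_approx {S : Type*} [Fintype S] (x : S → H) {η : ℝ} (hη : 0 < η) :
    ∃ O ∈ 𝓝 (Matrix.gram ℂ x), ∀ Q : H →L[ℂ] H, star Q = Q → Q * Q = Q →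
      ∀ y z : S → H, (∀ s, Q (y s) = y s) → (∀ s, Q (z s) = z s) →
        Matrix.gram ℂ y ∈ O → Matrix.gram ℂ z ∈ O →
        ∃ U : H →L[ℂ] H, star U * U = Q ∧ U * star U = Q ∧ ∀ s, ‖U (y s) - z s‖ < η := by
  obtain ⟨d, D, hD⟩ := exists_coordinates_of_gram_near x (half_pos hη)
  refine ⟨_, hD, fun Q hQs hQQ y z hy hz hyO hzO => ?_⟩
  have hspan : ∀ y : S → H, (∀ s, Q (y s) = y s) →
      ∀ v ∈ Submodule.span ℂ (Set.range y), Q v = v := by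
    intro y hy v hv
    have : Submodule.span ℂ (Set.range y) ≤ (Q - 1 : H →L[ℂ] H).ker := by
      refine Submodule.span_le.mpr ?_
      rintro _ ⟨s, rfl⟩
      simp [hy]
    simpa [sub_eq_zero] using this hv
  obtain ⟨u, hu, huspan, huy⟩ := hyO y rfl
  obtain ⟨w, hw, hwspan, hwz⟩ := hzO z rfl
  obtain ⟨U, hU, hU', hUuw⟩ := exists_corner_unitary Q hQs hQQ hu hw
    (fun i => hspan y hy _ (huspan i)) fun i => hspan z hz _ (hwspan i)
  refine ⟨U, hU, hU', fun s => ?_⟩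
  have hUnorm : ‖U‖ ≤ 1 := by
    have h := CStarRing.norm_star_mul_self (x := U)
    rw [hU] at h
    nlinarith [norm_nonneg U, IsStarProjection.norm_le Q ⟨hQQ, hQs⟩]
  have h1 : U (y s) - z s =
      U (y s - ∑ i, D s i • u i) - (z s - ∑ i, D s i • w i) := by
    simp only [map_sub, map_sum, map_smul, hUuw]
    abel
  rw [h1]
  refine (norm_sub_le _ _).trans_lt ?_
  have h2 := (U.le_of_opNorm_le hUnorm (y s - ∑ i, D s i • u i))
  linarith [huy s, hwz s]

end CornerApproximation

lemma exists_injective_forall_mem_of_infinite {T Λ : Type*} [Fintype T] (C : T → Set Λ)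
    (hC : ∀ t, (C t).Infinite) : ∃ σ : T → Λ, Function.Injective σ ∧ ∀ t, σ t ∈ C t := by
  classical
  choose F hF hcard using fun t => (hC t).exists_subset_card_eq (Fintype.card T)
  obtain ⟨σ, hσ, hmem⟩ := (Finset.all_card_le_biUnion_card_iff_exists_injective F).mp fun s => by
    rcases s.eq_empty_or_nonempty with rfl | ⟨t, ht⟩
    · simp
    · exact (Finset.card_le_univ s).trans
        ((hcard t).ge.trans (Finset.card_le_card (Finset.subset_biUnion_of_mem F ht)))
  exact ⟨σ, hσ, fun t => hF t (hmem t)⟩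

section DirectSum

variable {Λ : Type*} {X : Λ → Type*} [∀ l, NormedAddCommGroup (X l)]
  [∀ l, InnerProductSpace ℂ (X l)]

/-- The projection of a Hilbert sum onto the sum of finitely many summands. -/
noncomputable def coordProj [DecidableEq Λ] (G : Finset Λ) : lp X 2 →L[ℂ] lp X 2 :=
  ∑ l ∈ G, lp.singleContinuousLinearMap ℂ X 2 l ∘L lp.evalCLM ℂ X 2 l

variable [DecidableEq Λ]

lemma coordProj_apply (G : Finset Λ) (x : lp X 2) :
    coordProj G x = ∑ l ∈ G, lp.single 2 l (x l) := by
  simp [coordProj]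
  rfl

lemma coordProj_apply_apply (G : Finset Λ) (x : lp X 2) (l : Λ) :
    coordProj G x l = if l ∈ G then x l else 0 := by
  rw [coordProj_apply, lp.coeFn_sum, Finset.sum_apply]
  simp only [lp.single_apply]
  exact Finset.sum_pi_single l (fun l => x l) G

lemma coordProj_mul_self (G : Finset Λ) : coordProj (X := X) G * coordProj G = coordProj G := by
  ext x l
  simp +contextual [coordProj_apply_apply]

lemma star_coordProj [∀ l, CompleteSpace (X l)] (G : Finset Λ) :
    star (coordProj (X := X) G) = coordProj G := by
  rw [ContinuousLinearMap.star_eq_adjoint, eq_comm, ContinuousLinearMap.eq_adjoint_iff]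
  intro x y
  simp [coordProj_apply, sum_inner, inner_sum, lp.inner_single_left, lp.inner_single_right]

lemma tendsto_coordProj (x : lp X 2) :
    Filter.Tendsto (fun G => coordProj G x) Filter.atTop (nhds x) := by
  simpa [coordProj_apply, HasSum] using lp.hasSum_single ENNReal.ofNat_ne_top x

end DirectSum

/-- The moments of a finite tuple of vectors under an arbitrary representation are approximated by
those of finitely supported tuples under a direct sum with infinite multiplicities. -/
lemma exists_finite_support_inner_approx {A Λ : Type u} [NonUnitalCStarAlgebra A] [Nonempty Λ]
    (r : Λ → HilbertRep A)
    (hsep : ∀ a : Unitization ℂ A, a ≠ 0 → ∃ l : Λ, (r l).hom a ≠ 0)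
    (hequiv : ∀ l₀ : Λ, {l : Λ | (r l).UEquiv (r l₀)}.Infinite)
    (π : Unitization ℂ A →⋆ₐ[ℂ]
      (lp (fun l => (r l).carrier) 2 →L[ℂ] lp (fun l => (r l).carrier) 2))
    (hπ : ∀ (a : Unitization ℂ A) (x : lp (fun l => (r l).carrier) 2) (l : Λ),
      (π a x : ∀ l, (r l).carrier) l = (r l).hom a (x l))
    {K ι κ : Type*} [NormedAddCommGroup K] [InnerProductSpace ℂ K] [CompleteSpace K]
    [Fintype ι] [Fintype κ] (ρ : Unitization ℂ A →⋆ₐ[ℂ] (K →L[ℂ] K))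
    (c : κ → Unitization ℂ A) (e : ι → K) {δ : ℝ} (hδ : 0 < δ) :
    ∃ (F : Finset Λ) (f : ι → lp (fun l => (r l).carrier) 2),
      (∀ i, ∀ l ∉ F, (f i : ∀ l, (r l).carrier) l = 0) ∧
      ∀ k i j, ‖inner ℂ (f i) (π (c k) (f j)) - inner ℂ (e i) (ρ (c k) (e j))‖ < δ := by
  classical
  obtain ⟨T, _, l, f, hf⟩ := exists_sum_inner_approx (fun l => (r l).hom) hsep ρ c e hδ
  obtain ⟨σ, hσ, hσl⟩ := exists_injective_forall_mem_of_infinite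
    (fun t => {l' : Λ | (r l').UEquiv (r (l t))}) fun t => hequiv (l t)
  choose V hV using hσl
  let g : ι → lp (fun l => (r l).carrier) 2 := fun i =>
    ∑ t, lp.single 2 (σ t) ((V t).symm (f t i))
  have hg (i : ι) (l : Λ) :
      g i l = ∑ t, Pi.single (M := fun l => (r l).carrier) (σ t) ((V t).symm (f t i)) l := by
    simp only [g]
    rw [lp.coeFn_sum, Finset.sum_apply]
    simp only [lp.single_apply]
  have hgσ (i : ι) (t : T) : g i (σ t) = (V t).symm (f t i) := by
    rw [hg, Finset.sum_eq_single t]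
    · simp
    · exact fun t' _ ht' => Pi.single_eq_of_ne (hσ.ne ht'.symm) _
    · simp
  refine ⟨Finset.univ.image σ, g, fun i l hl => ?_, fun k i j => ?_⟩
  · rw [hg]
    refine Finset.sum_eq_zero fun t _ => Pi.single_eq_of_ne ?_ _
    rintro rfl
    exact hl (Finset.mem_image_of_mem σ (Finset.mem_univ t))
  · have h1 : inner ℂ (g i) (π (c k) (g j)) =
        ∑ t, inner ℂ (f t i) ((r (l t)).hom (c k) (f t j)) := by
      conv_lhs => enter [2]; simp only [g]
      rw [sum_inner]
      refine Finset.sum_congr rfl fun t _ => ?_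
      rw [lp.inner_single_left, hπ, hgσ, ← (V t).inner_map_map, hV]
      simp
    rw [h1]
    exact hf k i j

theorem stmt_5 (k m : Cardinal.{u}) (hk : ℵ₀ ≤ k) (hkm : k ≤ m)
    (A : Type u) [NonUnitalCStarAlgebra A]
    (Λ : Type u) (r : Λ → HilbertRep A)
    (hΛ : #Λ = m)
    (hnz : ∀ l : Λ, ∃ x : (r l).carrier, x ≠ 0)
    (hdim : ∀ l : Λ, (r l).dimLt k)
    (hsep : ∀ a : Unitization ℂ A, a ≠ 0 → ∃ l : Λ, (r l).hom a ≠ 0)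
    (hequiv : ∀ l₀ : Λ, #{l : Λ // (r l).UEquiv (r l₀)} = m)
    -- `π` is the direct sum of the `π_λ = (r λ).hom` acting coordinatewise on the
    -- Hilbert space direct sum `H = ⨁_{λ} X_λ = lp (fun λ => X_λ) 2`:
    (π : Unitization ℂ A →⋆ₐ[ℂ]
      (lp (fun l => (r l).carrier) 2 →L[ℂ] lp (fun l => (r l).carrier) 2))
    (hπ : ∀ (a : Unitization ℂ A) (x : lp (fun l => (r l).carrier) 2) (l : Λ),
      (π a x : ∀ l, (r l).carrier) l = (r l).hom a (x l))
    -- `ρ` is an arbitrary unital representation of `A⁺` on `H`: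
    (ρ : Unitization ℂ A →⋆ₐ[ℂ]
      (lp (fun l => (r l).carrier) 2 →L[ℂ] lp (fun l => (r l).carrier) 2))
    (ε : ℝ) (hε : 0 < ε)
    (W : Finset (Unitization ℂ A)) (E : Finset (lp (fun l => (r l).carrier) 2)) :
    ∃ F : Finset Λ, ∀ G : Finset Λ, F ⊆ G →
      -- `Q` is the orthogonal projection of `H` onto `⨁_{λ ∈ G} X_λ`:
      ∃ Q : lp (fun l => (r l).carrier) 2 →L[ℂ] lp (fun l => (r l).carrier) 2,
        (∀ (x : lp (fun l => (r l).carrier) 2) (l : Λ), l ∈ G →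
          (Q x : ∀ l, (r l).carrier) l = x l) ∧
        (∀ (x : lp (fun l => (r l).carrier) 2) (l : Λ), l ∉ G →
          (Q x : ∀ l, (r l).carrier) l = 0) ∧
        -- and there is a unitary `U` of the corner `Q B(H) Q` ...
        ∃ U : lp (fun l => (r l).carrier) 2 →L[ℂ] lp (fun l => (r l).carrier) 2,
          star U * U = Q ∧ U * star U = Q ∧
          -- ... with `‖(ρ(a) - U* π(a) U) e‖ < ε` for all `a ∈ W`, `e ∈ E`:
          ∀ a ∈ W, ∀ e ∈ E, ‖(ρ a - star U * π a * U) e‖ < ε := by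
  classical
  have hm : ℵ₀ ≤ m := hk.trans hkm
  have : Infinite Λ := infinite_iff.mpr (hΛ ▸ hm)
  have hinf (l₀ : Λ) : {l : Λ | (r l).UEquiv (r l₀)}.Infinite :=
    Set.infinite_coe_iff.mp (infinite_iff.mpr ((hequiv l₀).symm ▸ hm))
  obtain ⟨B, hB0, hB⟩ : ∃ B : ℝ, 0 ≤ B ∧ ∀ a ∈ W, ‖π a‖ ≤ B :=
    ⟨∑ a ∈ W, ‖π a‖, by positivity, fun a ha =>
      Finset.single_le_sum (f := fun a => ‖π a‖) (fun _ _ => norm_nonneg _) ha⟩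
  set η : ℝ := ε / (2 + B) with hη
  have hη0 : 0 < η := by positivity
  have hηε : (2 + B) * η = ε := by rw [hη]; field_simp
  let x : (insert 1 W : Finset (Unitization ℂ A)) × E → lp (fun l => (r l).carrier) 2 :=
    fun s => ρ s.1 s.2
  obtain ⟨O, hO, hU⟩ := exists_corner_unitary_approx x hη0
  obtain ⟨δ, hδ, hball⟩ := exists_forall_entry_lt_imp_mem_of_mem_nhds hO
  obtain ⟨F₁, f, hfF, hf⟩ := exists_finite_support_inner_approx r hsep hinf π hπ ρ
    (fun q : (insert 1 W : Finset (Unitization ℂ A)) × (insert 1 W : Finset (Unitization ℂ A)) =>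
      star (q.1 : Unitization ℂ A) * q.2) (fun e : E => e.1) hδ
  let y : (insert 1 W : Finset (Unitization ℂ A)) × E → lp (fun l => (r l).carrier) 2 :=
    fun s => π s.1 (f s.2)
  have hyO : Matrix.gram ℂ y ∈ O := by
    refine hball _ fun s t => ?_
    have h1 := hf (s.1, t.1) s.2 t.2
    simp only [map_mul, map_star, mul_apply_eq_comp, ContinuousLinearMap.star_eq_adjoint,
      ContinuousLinearMap.adjoint_inner_right] at h1
    exact h1
  have hQgram : ∀ᶠ G : Finset Λ in Filter.atTop, Matrix.gram ℂ (fun s => coordProj G (x s)) ∈ O := by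
    refine Filter.Tendsto.eventually_mem (f := fun G => Matrix.gram ℂ fun s => coordProj G (x s))
      ?_ hO
    refine tendsto_pi_nhds.mpr fun s => tendsto_pi_nhds.mpr fun t => ?_
    exact (tendsto_coordProj (x s)).inner (tendsto_coordProj (x t))
  have hQx : ∀ᶠ G : Finset Λ in Filter.atTop, ∀ s, ‖x s - coordProj G (x s)‖ < η := by
    refine Filter.eventually_all.mpr fun s => ?_
    refine ((tendsto_const_nhds.sub (tendsto_coordProj (x s))).norm).eventually_lt_const ?_
    simpa using hη0
  obtain ⟨F₂, hF₂⟩ := Filter.eventually_atTop.mp (hQgram.and hQx)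
  refine ⟨F₁ ∪ F₂, fun G hG => ⟨coordProj G, fun x l hl => ?_, fun x l hl => ?_, ?_⟩⟩
  · rw [coordProj_apply_apply, if_pos hl]
  · rw [coordProj_apply_apply, if_neg hl]
  obtain ⟨hGO, hGx⟩ := hF₂ G (Finset.union_subset_right hG)
  set Q := coordProj (X := fun l => (r l).carrier) G with hQ
  have hQQ : Q * Q = Q := coordProj_mul_self G
  have hQs : star Q = Q := star_coordProj G
  have hQQa (v) : Q (Q v) = Q v := DFunLike.congr_fun hQQ v
  obtain ⟨U, hUQ, hUQ', hUy⟩ := hU Q hQs hQQ (fun s => Q (x s)) y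
    (fun s => hQQa _) (fun s => by
      ext l
      rw [hQ, coordProj_apply_apply, ite_eq_left_iff]
      intro hl
      simp only [y]
      rw [hπ, hfF _ l fun h => hl (hG (Finset.mem_union_left _ h)), map_zero]) hGO hyO
  refine ⟨U, hUQ, hUQ', fun a ha e he => ?_⟩
  have hUs : ‖star U‖ ≤ 1 := by
    have h := CStarRing.norm_self_mul_star (x := U)
    rw [hUQ'] at h
    rw [norm_star]
    nlinarith [norm_nonneg U, IsStarProjection.norm_le Q ⟨hQQ, hQs⟩]
  have hUQU : U * Q = U := by
    have h1 : star (U * (1 - Q)) * (U * (1 - Q)) = 0 := by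
      rw [star_mul, mul_assoc, ← mul_assoc (star U), hUQ, mul_sub, hQQ, mul_one, sub_self, mul_zero]
    rw [CStarRing.star_mul_self_eq_zero_iff, mul_sub, mul_one, sub_eq_zero] at h1
    exact h1.symm
  let s₀ : (insert 1 W : Finset (Unitization ℂ A)) × E := (⟨1, by simp⟩, ⟨e, he⟩)
  let s : (insert 1 W : Finset (Unitization ℂ A)) × E := (⟨a, by simp [ha]⟩, ⟨e, he⟩)
  have hx₀ : U (Q (x s₀)) = U e := by
    have h1 : x s₀ = e := by simp [x, s₀]
    rw [h1]
    exact DFunLike.congr_fun hUQU e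
  have hy : π a (y s₀) = y s := by simp [y, s₀, s]
  have hUx : star U (U (Q (x s))) = Q (x s) := by
    have h1 : star U (U (Q (x s))) = Q (Q (x s)) := DFunLike.congr_fun hUQ _
    rw [h1, hQQa]
  have key : (ρ a - star U * π a * U) e = (x s - Q (x s)) +
      (star U (U (Q (x s)) - y s) - star U (π a (U (Q (x s₀)) - y s₀))) := by
    simp only [map_sub, hUx, hy, hx₀]
    simp [x, s]
  rw [key]
  have h1 := (star U).le_of_opNorm_le hUs (U (Q (x s)) - y s)
  have h2 := (star U).le_of_opNorm_le hUs (π a (U (Q (x s₀)) - y s₀))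
  have h3 := (π a).le_of_opNorm_le (hB a ha) (U (Q (x s₀)) - y s₀)
  have h4 := mul_le_mul_of_nonneg_left (hUy s₀).le hB0
  refine (norm_add_le _ _).trans_lt ?_
  have h5 := norm_sub_le (star U (U (Q (x s)) - y s)) (star U (π a (U (Q (x s₀)) - y s₀)))
  linarith [hGx s, hUy s]
end

section
/- Let m be an infinite cardinal, let A be an m-generated C*-algebra, let M be a complex Hilbert space, and let τ : A → B(M) be a *-homomorphism admitting a cyclic vector, i.e. there exists f ∈ M such that the closure of { τ(a) f : a ∈ A } equals M. Then the Hilbert dimension of M is at most m. -/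
/- STATEMENT 9: a cyclic representation of an `m`-generated C*-algebra acts on a Hilbert
space of Hilbert dimension at most `m`. -/

open Cardinal

universe u

theorem HilbertBasis.countable_support_inner {𝕜 ι E : Type*} [RCLike 𝕜] [NormedAddCommGroup E]
    [InnerProductSpace 𝕜 E] (b : HilbertBasis ι 𝕜 E) (x : E) :
    {i | inner 𝕜 (b i) x ≠ 0}.Countable := by
  refine (b.summable_inner_mul_inner x x).countable_support.mono fun i hi => ?_
  have hi' : inner 𝕜 x (b i) ≠ 0 := fun h => hi (inner_eq_zero_symm.1 h)
  exact mul_ne_zero hi' hi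

/-- The cardinality of a Hilbert basis is at most that of any family with dense linear span, or
`ℵ₀` if that family is finite. -/
theorem HilbertBasis.mk_le_max_of_dense_span {𝕜 : Type*} {ι κ E : Type u} [RCLike 𝕜]
    [NormedAddCommGroup E] [InnerProductSpace 𝕜 E] (b : HilbertBasis ι 𝕜 E) (v : κ → E)
    (hv : Dense (Submodule.span 𝕜 (Set.range v) : Set E)) : #ι ≤ max ℵ₀ #κ := by
  have hcover : (⋃ k, {i | inner 𝕜 (b i) (v k) ≠ 0}) = Set.univ := by
    rw [Set.eq_univ_iff_forall]
    intro i
    by_contra hi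
    simp only [Set.mem_iUnion, Set.mem_ofPred_eq, not_exists, not_not] at hi
    refine b.orthonormal.ne_zero i (hv.eq_zero_of_inner_left 𝕜 fun x hx => ?_)
    induction hx using Submodule.span_induction with
    | mem x hx => obtain ⟨k, rfl⟩ := hx; exact hi k
    | zero => exact inner_zero_right _
    | add x y _ _ hx hy => rw [inner_add_right, hx, hy, add_zero]
    | smul c x _ hx => rw [inner_smul_right, hx, mul_zero]
  calc #ι = #(⋃ k, {i | inner 𝕜 (b i) (v k) ≠ 0}) := by rw [hcover, mk_univ]
    _ ≤ #κ * ⨆ k, #{i | inner 𝕜 (b i) (v k) ≠ 0} := mk_iUnion_le _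
    _ ≤ #κ * ℵ₀ := by
      gcongr
      exact ciSup_le' fun k => (b.countable_support_inner (v k)).le_aleph0
    _ ≤ max ℵ₀ #κ := (mul_le_max_of_aleph0_le_right le_rfl).trans (max_comm _ _).le

/-- A multiplicative map into a monoid sends the subsemigroup generated by a set to products of
lists of images of generators. -/
theorem Subsemigroup.exists_list_prod_of_mem_closure {S N : Type*} [Semigroup S] [Monoid N]
    (φ : S →ₙ* N) {s : Set S} {a : S} (ha : a ∈ Subsemigroup.closure s) :
    ∃ l : List s, φ a = (l.map fun x : s => φ x).prod := by
  induction ha using Subsemigroup.closure_induction with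
  | mem x hx => exact ⟨[⟨x, hx⟩], by simp⟩
  | mul x y _ _ hx hy =>
    obtain ⟨l, hl⟩ := hx
    obtain ⟨l', hl'⟩ := hy
    exact ⟨l ++ l', by rw [map_mul, hl, hl', List.map_append, List.prod_append]⟩

theorem stmt_9 (m : Cardinal.{u}) (hm : ℵ₀ ≤ m)
    (A : Type u) [NonUnitalCStarAlgebra A] (hgen : MGenerated m A)
    (M : Type u) [NormedAddCommGroup M] [InnerProductSpace ℂ M] [CompleteSpace M]
    (τ : A →⋆ₙₐ[ℂ] (M →L[ℂ] M))
    (f : M) (hf : Dense (Set.range fun a : A => τ a f)) :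
    ∀ (ι : Type u) (_ : HilbertBasis ι ℂ M), #ι ≤ m := by
  intro ι b
  obtain ⟨G, hG, hdense⟩ := hgen
  set s : Set A := G ∪ star G
  have hs : #s ≤ m := by
    have hstar : #(star G : Set A) ≤ m := by
      rw [← Set.image_star]
      exact mk_image_le.trans hG
    exact (mk_union_le _ _).trans (add_le_of_le hm hG hstar)
  have hlist : #(List s) ≤ m := (mk_list_le_max s).trans (max_le hm hs)
  let v : List s → M := fun l => (l.map fun x : s => τ x).prod f
  refine (b.mk_le_max_of_dense_span v ?_).trans (max_le hm hlist)
  have hτ : Continuous τ :=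
    AddMonoidHomClass.continuous_of_bound τ 1 fun a => by
      simpa only [one_mul] using NonUnitalStarAlgHom.norm_apply_le τ a
  have hcont : Continuous fun a : A => τ a f := hτ.clm_apply continuous_const
  have hadjoin : Dense (NonUnitalStarAlgebra.adjoin ℂ G : Set A) := fun a => by
    change a ∈ (NonUnitalStarAlgebra.adjoin ℂ G).topologicalClosure
    simp [hdense]
  refine (DenseRange.dense_image hf hcont hadjoin).mono ?_
  rintro _ ⟨a, ha, rfl⟩
  have ha' : a ∈ Submodule.span ℂ (Subsemigroup.closure s : Set A) := by
    rw [← NonUnitalStarAlgebra.adjoin_eq_span]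
    exact ha
  clear ha
  simp only [SetLike.mem_coe]
  induction ha' using Submodule.span_induction with
  | mem x hx =>
    obtain ⟨l, hl⟩ := Subsemigroup.exists_list_prod_of_mem_closure
      (MulHomClass.toMulHom τ) hx
    exact Submodule.subset_span ⟨l, (congrArg (fun T : M →L[ℂ] M => T f) hl).symm⟩
  | zero => simp
  | add x y _ _ hx hy => simpa using add_mem hx hy
  | smul c x _ hx => simpa using Submodule.smul_mem _ c hx
end
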